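/- Let G be a near-triangulation that is a vertex-minimal plane graph which is not 3-dynamically L-colorable for some list assignment L with all lists of size at least 6 (so every near-triangulation with fewer vertices is 3-dynamically k-choosable for k = 6). Then every vertex of G not lying on the boundary cycle of the outer face has degree at least 6 in G. -/

import Mathlib

open SimpleGraph

/-- A rotation system on a finite connected simple graph: a permutation of the darts that
fixes the tail of each dart and acts transitively on the darts with a given tail
(i.e. a cyclic order of the darts around each vertex). -/
structure RotationSystem (V : Type) [Fintype V] [DecidableEq V] where
  graph : SimpleGraph V
  conn : graph.Connected
  rot : Equiv.Perm graph.Dart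
  rot_fst : ∀ d : graph.Dart, (rot d).fst = d.fst
  rot_orbit : ∀ d e : graph.Dart, d.fst = e.fst → ∃ n : ℕ, (rot ^ n) d = e

namespace RotationSystem

variable {V : Type} [Fintype V] [DecidableEq V] (P : RotationSystem V)

/-- The face-traversal permutation of the darts. -/
def facePerm : Equiv.Perm P.graph.Dart :=
  (Function.Involutive.toPerm _ (Dart.symm_involutive (G := P.graph))).trans P.rot

/-- Two darts lie on (the boundary walk of) the same face. -/
def SameFace (d e : P.graph.Dart) : Prop := P.facePerm.SameCycle d e

/-- The faces of the embedding, as orbits of the face-traversal permutation. -/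
def faceSetoid : Setoid P.graph.Dart :=
  ⟨P.facePerm.SameCycle,
    ⟨fun x => Equiv.Perm.SameCycle.refl _ x, fun h => h.symm, fun h h' => h.trans h'⟩⟩

/-- The number of faces of the embedding. -/
noncomputable def numFaces : ℕ := Nat.card (Quotient P.faceSetoid)

/-- The rotation system is a plane (genus zero) embedding: Euler's formula holds. -/
def IsPlane : Prop :=
  (Fintype.card V : ℤ) - Nat.card P.graph.edgeSet + P.numFaces = 2

/-- The number of darts on the boundary walk of the face containing dart `d`. -/
noncomputable def faceSize (d : P.graph.Dart) : ℕ := Set.ncard {e | P.SameFace d e}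

end RotationSystem

/-- A near-triangulation: a connected plane graph, with a distinguished (outer) face,
all of whose other (bounded) faces are 3-cycles. -/
structure NearTriangulation (V : Type) [Fintype V] [DecidableEq V]
    extends RotationSystem V where
  outer : graph.Dart
  plane : toRotationSystem.IsPlane
  bounded_tri : ∀ d : graph.Dart,
    ¬ toRotationSystem.SameFace outer d → toRotationSystem.faceSize d = 3

/-- A vertex lies on the boundary of the outer face. -/
def NearTriangulation.OnOuter {V : Type} [Fintype V] [DecidableEq V]
    (P : NearTriangulation V) (v : V) : Prop :=
  ∃ d : P.graph.Dart, P.toRotationSystem.SameFace P.outer d ∧ d.fst = v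

/-- An `r`-dynamic coloring: a proper coloring such that each vertex `v` sees at least
`min r (deg v)` distinct colors on its neighborhood. -/
def IsDynColoring {V : Type} (G : SimpleGraph V) (r : ℕ) (φ : V → ℕ) : Prop :=
  (∀ ⦃u v : V⦄, G.Adj u v → φ u ≠ φ v) ∧
  ∀ v : V, min r ((G.neighborSet v).ncard) ≤ (φ '' G.neighborSet v).ncard

instance SimpleGraph.finite_dart {V : Type*} [Finite V] (G : SimpleGraph V) : Finite G.Dart :=
  Finite.of_injective _ Dart.toProd_injective

namespace RotationSystem

section Basic

variable {V : Type} [Fintype V] [DecidableEq V] (P : RotationSystem V)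

theorem facePerm_apply (d : P.graph.Dart) : P.facePerm d = P.rot d.symm := rfl

theorem facePerm_symm_apply (d : P.graph.Dart) : P.facePerm d.symm = P.rot d := by
  rw [facePerm_apply, Dart.symm_symm]

theorem facePerm_fst (d : P.graph.Dart) : (P.facePerm d).fst = d.snd :=
  P.rot_fst d.symm

theorem rot_pow_fst (d : P.graph.Dart) (n : ℕ) : ((P.rot ^ n) d).fst = d.fst := by
  induction n with
  | zero => rfl
  | succ n ih => rw [pow_succ', Equiv.Perm.mul_apply, P.rot_fst, ih]

theorem rot_isCycleOn (v : V) : P.rot.IsCycleOn {d : P.graph.Dart | d.fst = v} := by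
  refine ⟨⟨fun d hd => (P.rot_fst d).trans hd, P.rot.injective.injOn, fun d hd => ?_⟩, ?_⟩
  · refine ⟨P.rot.symm d, ?_, P.rot.apply_symm_apply d⟩
    have := P.rot_fst (P.rot.symm d)
    rw [P.rot.apply_symm_apply] at this
    exact this.symm.trans hd
  · intro d hd e he
    obtain ⟨n, hn⟩ := P.rot_orbit d e (hd.trans he.symm)
    exact ⟨n, by simpa using hn⟩

theorem ncard_darts_at (v : V) :
    {d : P.graph.Dart | d.fst = v}.ncard = (P.graph.neighborSet v).ncard := by
  refine Set.ncard_congr (fun d _ => d.snd) ?_ ?_ ?_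
  · rintro d rfl
    exact d.adj
  · intro d e hd he h
    exact Dart.ext _ _ (Prod.ext (hd.trans he.symm) h)
  · intro x hx
    exact ⟨⟨(v, x), hx⟩, rfl, rfl⟩

theorem facePerm_isCycleOn (d : P.graph.Dart) : P.facePerm.IsCycleOn {e | P.SameFace d e} := by
  refine ⟨⟨fun e he => ?_, P.facePerm.injective.injOn, fun e he => ?_⟩, ?_⟩
  · exact Equiv.Perm.sameCycle_apply_right.2 he
  · exact ⟨P.facePerm.symm e, Equiv.Perm.sameCycle_symm_apply_right.2 he,
      P.facePerm.apply_symm_apply e⟩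
  · exact fun e he e' he' => he.symm.trans he'

theorem facePerm_pow_three {d : P.graph.Dart} (h : P.faceSize d = 3) :
    P.facePerm (P.facePerm (P.facePerm d)) = d := by
  classical
  have hf : {e | P.SameFace d e}.Finite := Set.toFinite _
  have hc := P.facePerm_isCycleOn d
  rw [← hf.coe_toFinset] at hc
  have := hc.pow_card_apply (a := d) (hf.mem_toFinset.2 (Equiv.Perm.SameCycle.refl _ _))
  rw [← Set.ncard_eq_toFinset_card, show {e | P.SameFace d e}.ncard = 3 from h] at this
  exact this

theorem sameFace_iff_of_faceSize {d : P.graph.Dart} (h : P.faceSize d = 3) (e : P.graph.Dart) :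
    P.SameFace d e ↔ e = d ∨ e = P.facePerm d ∨ e = P.facePerm (P.facePerm d) := by
  have h3 := P.facePerm_pow_three h
  constructor
  · intro he
    obtain ⟨n, rfl⟩ := (P.facePerm_isCycleOn d).exists_pow_eq' (Set.toFinite _)
      (Equiv.Perm.SameCycle.refl _ _) he
    induction n with
    | zero => exact Or.inl rfl
    | succ n ih =>
      rw [pow_succ', Equiv.Perm.mul_apply]
      have hn : P.SameFace d ((P.facePerm ^ n) d) :=
        Equiv.Perm.sameCycle_pow_right.2 (Equiv.Perm.SameCycle.refl _ _)
      rcases ih hn with h | h | h <;> rw [h]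
      · exact Or.inr (Or.inl rfl)
      · exact Or.inr (Or.inr rfl)
      · exact Or.inl h3
  · rintro (rfl | rfl | rfl)
    · exact Equiv.Perm.SameCycle.refl _ _
    · exact Equiv.Perm.sameCycle_apply_right.2 (Equiv.Perm.SameCycle.refl _ _)
    · exact Equiv.Perm.sameCycle_apply_right.2
        (Equiv.Perm.sameCycle_apply_right.2 (Equiv.Perm.SameCycle.refl _ _))

/-- The end of the dart reached from `d` by rotating `i` times around its tail. -/
def nbr (d : P.graph.Dart) (i : ℕ) : V := ((P.rot ^ i) d).snd

theorem rot_pow_eq_mk (d : P.graph.Dart) (i : ℕ) :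
    ((P.rot ^ i) d).toProd = (d.fst, P.nbr d i) :=
  Prod.ext (P.rot_pow_fst d i) rfl

theorem adj_nbr (d : P.graph.Dart) (i : ℕ) : P.graph.Adj d.fst (P.nbr d i) := by
  have := ((P.rot ^ i) d).adj
  rwa [P.rot_pow_fst] at this

theorem nbr_rot_pow (d : P.graph.Dart) (i j : ℕ) :
    P.nbr ((P.rot ^ j) d) i = P.nbr d (i + j) := by
  rw [nbr, nbr, pow_add, Equiv.Perm.mul_apply]

theorem nbr_eq_nbr_iff (d : P.graph.Dart) (i j : ℕ) :
    P.nbr d i = P.nbr d j ↔ i ≡ j [MOD (P.graph.neighborSet d.fst).ncard] := by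
  classical
  have hf : {e : P.graph.Dart | e.fst = d.fst}.Finite := Set.toFinite _
  have hc := P.rot_isCycleOn d.fst
  rw [← P.ncard_darts_at, Set.ncard_eq_toFinset_card _ hf]
  rw [← hf.coe_toFinset] at hc
  rw [← hc.pow_apply_eq_pow_apply (a := d) (by simp)]
  constructor
  · intro h
    exact Dart.ext _ _ (by rw [rot_pow_eq_mk, rot_pow_eq_mk, h])
  · intro h
    rw [nbr, h, nbr]

theorem exists_nbr_eq (d : P.graph.Dart) {x : V} (h : P.graph.Adj d.fst x) :
    ∃ i < (P.graph.neighborSet d.fst).ncard, P.nbr d i = x := by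
  classical
  have hf : {e : P.graph.Dart | e.fst = d.fst}.Finite := Set.toFinite _
  have hc := P.rot_isCycleOn d.fst
  rw [← P.ncard_darts_at, Set.ncard_eq_toFinset_card _ hf]
  rw [← hf.coe_toFinset] at hc
  obtain ⟨n, hn, hx⟩ := hc.exists_pow_eq (a := d) (b := ⟨(d.fst, x), h⟩) (by simp) (by simp)
  exact ⟨n, hn, by rw [nbr, hx]⟩

theorem nbr_injOn (d : P.graph.Dart) {i j : ℕ} (hi : i < (P.graph.neighborSet d.fst).ncard)
    (hj : j < (P.graph.neighborSet d.fst).ncard) (h : P.nbr d i = P.nbr d j) : i = j :=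
  Nat.ModEq.eq_of_lt_of_lt ((P.nbr_eq_nbr_iff d i j).1 h) hi hj

/-- A nonempty set of vertices closed under adjacency contains all vertices. -/
theorem eq_univ_of_adj_closed (S : Set V) {x : V} (hx : x ∈ S)
    (h : ∀ y ∈ S, ∀ z, P.graph.Adj y z → z ∈ S) (y : V) : y ∈ S := by
  obtain ⟨w⟩ := P.conn.preconnected x y
  induction w with
  | nil => exact hx
  | cons hadj _ ih => exact ih (h _ hx _ hadj)

/-- All faces at `v` are triangles. -/
def IsInner (v : V) : Prop := ∀ d : P.graph.Dart, d.fst = v → P.faceSize d = 3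

variable {P}

namespace IsInner

variable {v : V} (hv : P.IsInner v)
include hv

theorem facePerm_facePerm_rot {d : P.graph.Dart} (hd : d.fst = v) :
    P.facePerm (P.facePerm (P.rot d)) = d.symm := by
  have h := P.facePerm_pow_three (hv (P.rot d) ((P.rot_fst d).trans hd))
  rw [← P.facePerm_symm_apply d] at h
  rw [← P.facePerm_symm_apply d]
  exact P.facePerm.injective h

theorem facePerm_rot {d : P.graph.Dart} (hd : d.fst = v) :
    (P.facePerm (P.rot d)).toProd = ((P.rot d).snd, d.snd) := by
  refine Prod.ext (P.facePerm_fst _) ?_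
  have h := congrArg (fun e : P.graph.Dart => e.fst) (hv.facePerm_facePerm_rot hd)
  simp only [P.facePerm_fst] at h
  exact h

theorem adj_rot {d : P.graph.Dart} (hd : d.fst = v) :
    P.graph.Adj (P.rot d).snd d.snd := by
  have := (P.facePerm (P.rot d)).adj
  rwa [hv.facePerm_rot hd] at this

theorem adj_nbr_succ {d : P.graph.Dart} (hd : d.fst = v) (i : ℕ) :
    P.graph.Adj (P.nbr d i) (P.nbr d (i + 1)) := by
  have := hv.adj_rot (d := (P.rot ^ i) d) ((P.rot_pow_fst d i).trans hd)
  rw [nbr, nbr, pow_succ', Equiv.Perm.mul_apply]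
  exact this.symm

end IsInner

end Basic

end RotationSystem

theorem NearTriangulation.not_sameFace_outer {V : Type} [Fintype V] [DecidableEq V]
    (P : NearTriangulation V) {v : V} (hv : ¬ P.OnOuter v) (d : P.graph.Dart)
    (hd : d.fst = v ∨ d.snd = v) : ¬ P.toRotationSystem.SameFace P.outer d := by
  rcases hd with hd | hd
  · exact fun h => hv ⟨d, h, hd⟩
  · exact fun h => hv ⟨P.facePerm d, Equiv.Perm.sameCycle_apply_right.2 h,
      (P.facePerm_fst d).trans hd⟩

theorem NearTriangulation.isInner {V : Type} [Fintype V] [DecidableEq V]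
    (P : NearTriangulation V) {v : V} (hv : ¬ P.OnOuter v) : P.toRotationSystem.IsInner v :=
  fun d hd => P.bounded_tri d (P.not_sameFace_outer hv d (Or.inl hd))

theorem Submodule.mem_of_dotProduct_eq_zero {K E : Type*} [Field K] [Fintype E]
    (W₁ W₂ : Submodule K (E → K)) (h : ∀ x ∈ W₁, ∀ y ∈ W₂, y ⬝ᵥ x = 0)
    (hdim : Fintype.card E ≤ Module.finrank K W₁ + Module.finrank K W₂)
    {x : E → K} (hx : ∀ y ∈ W₂, y ⬝ᵥ x = 0) : x ∈ W₁ := by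
  let B : LinearMap.BilinForm K (E → K) := dotProductBilin K K
  have hB : B.Nondegenerate :=
    ⟨fun v hv => dotProduct_eq_zero v hv,
      fun v hv => dotProduct_eq_zero v fun w => (dotProduct_comm v w).trans (hv w)⟩
  have hle : W₁ ≤ B.orthogonal W₂ := fun x hx y hy => h x hx y hy
  have hfin := LinearMap.BilinForm.finrank_orthogonal hB W₂
  rw [Module.finrank_fintype_fun_eq_card] at hfin
  rw [Submodule.eq_of_le_of_finrank_le hle (by omega)]
  exact fun y hy => hx y hy

theorem LinearMap.card_le_finrank_range_add_one {K X M : Type*} [Field K] [Fintype X]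
    [AddCommGroup M] [Module K M] (T : (X → K) →ₗ[K] M)
    (hT : ∀ f, T f = 0 → ∀ x y, f x = f y) :
    Fintype.card X ≤ Module.finrank K (LinearMap.range T) + 1 := by
  have h := T.finrank_range_add_finrank_ker
  rw [Module.finrank_fintype_fun_eq_card] at h
  have hker : LinearMap.ker T ≤ Submodule.span K {1} := by
    intro f hf
    rcases isEmpty_or_nonempty X with hX | ⟨⟨x⟩⟩
    · rw [Subsingleton.elim f 0]
      exact zero_mem _
    · refine Submodule.mem_span_singleton.2 ⟨f x, funext fun y => ?_⟩
      simpa using hT f hf x y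
  have h1 := Submodule.finrank_mono hker
  have h2 := finrank_span_le_card (R := K) ({1} : Set (X → K))
  simp only [Set.toFinset_singleton, Finset.card_singleton] at h2
  omega

namespace RotationSystem

section Jordan

variable {V : Type} [Fintype V] [DecidableEq V] (P : RotationSystem V)

theorem eq_of_adj_eq {α : Type*} (h : V → α) (hadj : ∀ x y, P.graph.Adj x y → h x = h y)
    (x y : V) : h x = h y :=
  (P.eq_univ_of_adj_closed {z | h x = h z} rfl (fun y hy z hz => hy.trans (hadj y z hz)) y)

theorem eq_of_rot_eq {α : Type*} (g : P.graph.Dart → α) {v : V}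
    (hrot : ∀ d : P.graph.Dart, d.fst = v → g (P.rot d) = g d) {d e : P.graph.Dart}
    (hd : d.fst = v) (he : e.fst = v) : g d = g e := by
  obtain ⟨n, rfl⟩ := P.rot_orbit d e (hd.trans he.symm)
  clear he
  induction n with
  | zero => rfl
  | succ n ih =>
    rw [pow_succ', Equiv.Perm.mul_apply, hrot _ ((P.rot_pow_fst d n).trans hd), ← ih]

theorem eq_of_facePerm_eq_of_symm_eq {α : Type*} (g : P.graph.Dart → α)
    (hface : ∀ d, g (P.facePerm d) = g d) (hsymm : ∀ d, g d.symm = g d) (d e : P.graph.Dart) :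
    g d = g e := by
  have hrot : ∀ d, g (P.rot d) = g d := fun d => by
    rw [← P.facePerm_symm_apply, hface, hsymm]
  have key : ∀ x, ∀ d e : P.graph.Dart, d.fst = x → e.fst = x → g d = g e :=
    fun x d e hd he => P.eq_of_rot_eq g (fun d _ => hrot d) hd he
  have := P.eq_univ_of_adj_closed {x | ∀ e : P.graph.Dart, e.fst = x → g d = g e}
    (x := d.fst) (fun e he => key _ d e rfl he) (fun y hy z hyz e he => by
      rw [hy ⟨(y, z), hyz⟩ rfl, ← hsymm]
      exact key z _ e rfl he) e.fst
  exact this e rfl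

/-- In a plane embedding, a cycle of length three separates the faces into two classes. -/
theorem IsPlane.exists_face_potential (hP : P.IsPlane) {x y z : V} (hxy : P.graph.Adj x y)
    (hyz : P.graph.Adj y z) (hzx : P.graph.Adj z x) :
    ∃ g : P.graph.Dart → ZMod 2, (∀ d, g (P.facePerm d) = g d) ∧
      ∀ d, g d + g d.symm = if d.edge = s(x, y) ∨ d.edge = s(y, z) ∨ d.edge = s(z, x)
        then 1 else 0 := by
  classical
  have := Fintype.ofFinite (Quotient P.faceSetoid)
  let T : (Quotient P.faceSetoid → ZMod 2) →ₗ[ZMod 2] (P.graph.edgeSet → ZMod 2) :=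
    { toFun f e := ∑ d : P.graph.Dart with d.edge = e.1, f (Quotient.mk _ d)
      map_add' f f' := funext fun e => by simp [Finset.sum_add_distrib]
      map_smul' r f := funext fun e => by simp [Finset.mul_sum] }
  let δ : (V → ZMod 2) →ₗ[ZMod 2] (P.graph.edgeSet → ZMod 2) :=
    { toFun h e := Sym2.lift ⟨fun a b => h a + h b, fun a b => add_comm _ _⟩ e.1
      map_add' h h' := funext fun ⟨e, he⟩ => by
        induction e with | h a b => simp only [Sym2.lift_mk, Pi.add_apply]; ring
      map_smul' r h := funext fun ⟨e, he⟩ => by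
        induction e with | h a b => simp [mul_add] }
  have hT : ∀ f (d : P.graph.Dart), T f ⟨d.edge, d.edge_mem⟩ =
      f (Quotient.mk _ d) + f (Quotient.mk _ d.symm) := fun f d => by
    change ∑ d' : P.graph.Dart with d'.edge = d.edge, f (Quotient.mk _ d') = _
    rw [d.edge_fiber, Finset.sum_pair d.symm_ne.symm]
  have hmk : ∀ d, (Quotient.mk P.faceSetoid (P.facePerm d)) = Quotient.mk _ d := fun d =>
    Quotient.sound (Equiv.Perm.sameCycle_apply_left.2 (Equiv.Perm.SameCycle.refl _ _))
  have hTrank : Fintype.card (Quotient P.faceSetoid) ≤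
      Module.finrank (ZMod 2) (LinearMap.range T) + 1 := by
    refine LinearMap.card_le_finrank_range_add_one T fun f hf q q' => ?_
    induction q using Quotient.ind with | _ d
    induction q' using Quotient.ind with | _ e
    refine P.eq_of_facePerm_eq_of_symm_eq (fun d => f (Quotient.mk _ d))
      (fun d => congrArg f (hmk d)) (fun d => ?_) d e
    have := hT f d
    rw [hf, Pi.zero_apply] at this
    exact (CharTwo.add_eq_zero.1 this.symm).symm
  have hδrank : Fintype.card V ≤ Module.finrank (ZMod 2) (LinearMap.range δ) + 1 := by
    refine LinearMap.card_le_finrank_range_add_one δ fun h hh a b => ?_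
    refine P.eq_of_adj_eq h (fun a b hab => ?_) a b
    have := congrFun hh ⟨s(a, b), hab⟩
    exact CharTwo.add_eq_zero.1 this
  have horth : ∀ c ∈ LinearMap.range T, ∀ k ∈ LinearMap.range δ, k ⬝ᵥ c = 0 := by
    rintro _ ⟨f, rfl⟩ _ ⟨h, rfl⟩
    have h1 : δ h ⬝ᵥ T f = ∑ d : P.graph.Dart, (h d.fst + h d.snd) * f (Quotient.mk _ d) := by
      rw [dotProduct, ← Finset.sum_fiberwise (s := Finset.univ)
        (g := fun d : P.graph.Dart => (⟨d.edge, d.edge_mem⟩ : P.graph.edgeSet))]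
      refine Finset.sum_congr rfl fun e _ => ?_
      change _ * (∑ d : P.graph.Dart with d.edge = e.1, f (Quotient.mk _ d)) = _
      rw [Finset.mul_sum]
      refine Finset.sum_congr (by ext; simp [Subtype.ext_iff]) fun d hd => ?_
      obtain rfl : (⟨d.edge, d.edge_mem⟩ : P.graph.edgeSet) = e := by
        simpa [Subtype.ext_iff] using hd
      rfl
    have h2 : ∑ d : P.graph.Dart, h d.snd * f (Quotient.mk _ d) =
        ∑ d : P.graph.Dart, h d.fst * f (Quotient.mk _ d) := by
      rw [← Equiv.sum_comp P.facePerm (fun d => h d.fst * f (Quotient.mk _ d))]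
      exact Finset.sum_congr rfl fun d _ => by rw [P.facePerm_fst, hmk]
    rw [h1]
    simp only [add_mul, Finset.sum_add_distrib]
    rw [h2, CharTwo.add_self_eq_zero]
  let c : P.graph.edgeSet → ZMod 2 := fun e =>
    if e.1 = s(x, y) ∨ e.1 = s(y, z) ∨ e.1 = s(z, x) then 1 else 0
  have hc : ∀ k ∈ LinearMap.range δ, k ⬝ᵥ c = 0 := by
    rintro _ ⟨h, rfl⟩
    let e₁ : P.graph.edgeSet := ⟨s(x, y), hxy⟩
    let e₂ : P.graph.edgeSet := ⟨s(y, z), hyz⟩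
    let e₃ : P.graph.edgeSet := ⟨s(z, x), hzx⟩
    have h12 : e₁ ≠ e₂ := by
      simp [e₁, e₂, Subtype.ext_iff, hxy.ne, hzx.ne.symm]
    have h13 : e₁ ≠ e₃ := by
      simp [e₁, e₃, Subtype.ext_iff, hyz.ne, hzx.ne.symm]
    have h23 : e₂ ≠ e₃ := by
      simp [e₂, e₃, Subtype.ext_iff, hyz.ne, hxy.ne.symm]
    have h1 : δ h ⬝ᵥ c = ∑ e ∈ {e₁, e₂, e₃}, δ h e := by
      rw [dotProduct, ← Finset.sum_filter_add_sum_filter_not Finset.univ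
        (fun e => e ∈ ({e₁, e₂, e₃} : Finset P.graph.edgeSet))]
      rw [Finset.sum_eq_zero (s := Finset.univ.filter fun e => ¬ _), add_zero]
      · refine Finset.sum_congr (by ext; simp) fun e he => ?_
        have : c e = 1 := if_pos (by simpa [e₁, e₂, e₃, Subtype.ext_iff] using he)
        rw [this, mul_one]
      · intro e he
        have : c e = 0 := if_neg (by simpa [e₁, e₂, e₃, Subtype.ext_iff] using he)
        rw [this, mul_zero]
    rw [h1, Finset.sum_insert (by simp [h12, h13]), Finset.sum_pair h23]
    change h x + h y + (h y + h z + (h z + h x)) = 0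
    linear_combination (h x + h y + h z) * (CharTwo.two_eq_zero : (2 : ZMod 2) = 0)
  have hdim : Fintype.card P.graph.edgeSet ≤ Module.finrank (ZMod 2) (LinearMap.range T) +
      Module.finrank (ZMod 2) (LinearMap.range δ) := by
    have := hP
    rw [IsPlane, numFaces, Nat.card_eq_fintype_card, Nat.card_eq_fintype_card] at this
    omega
  obtain ⟨f, hf⟩ := Submodule.mem_of_dotProduct_eq_zero _ _ horth hdim hc
  refine ⟨fun d => f (Quotient.mk _ d), fun d => congrArg f (hmk d), fun d => ?_⟩
  rw [← hT, hf]

/-- Two chords of the link of `v` drawn in the same plane do not cross. -/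
theorem IsPlane.not_adj_of_adj (hP : P.IsPlane) (d : P.graph.Dart) {k : ℕ} (hk : 3 ≤ k)
    (hkd : k < (P.graph.neighborSet d.fst).ncard)
    (h02 : P.graph.Adj (P.nbr d 0) (P.nbr d 2)) :
    ¬ P.graph.Adj (P.nbr d 1) (P.nbr d k) := by
  intro h1k
  obtain ⟨g, hface, hsymm⟩ := hP.exists_face_potential P (P.adj_nbr d 0) h02 (P.adj_nbr d 2).symm
  set v := d.fst with hv
  have hne : ∀ {i j}, i < (P.graph.neighborSet v).ncard → j < (P.graph.neighborSet v).ncard →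
      i ≠ j → P.nbr d i ≠ P.nbr d j := fun hi hj hij h => hij (P.nbr_injOn d hi hj h)
  have hnv : ∀ i, P.nbr d i ≠ v := fun i => (P.adj_nbr d i).ne'
  have hoff : ∀ e : P.graph.Dart, e.fst ≠ v → e.fst ≠ P.nbr d 0 → e.fst ≠ P.nbr d 2 →
      g e.symm = g e := by
    intro e h1 h2 h3
    have := hsymm e
    rw [if_neg (by simp [Dart.edge, Prod.ext_iff, h1, h2, h3]), CharTwo.add_eq_zero] at this
    exact this.symm
  have hconst : ∀ x, x ≠ v → x ≠ P.nbr d 0 → x ≠ P.nbr d 2 → ∀ e e' : P.graph.Dart,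
      e.fst = x → e'.fst = x → g e = g e' := by
    intro x h1 h2 h3 e e' he he'
    refine P.eq_of_rot_eq g (fun e he => ?_) he he'
    subst he
    rw [← P.facePerm_symm_apply, hface, hoff e h1 h2 h3]
  have hrot : ∀ i, g ((P.rot ^ (i + 1)) d) = g ((P.rot ^ i) d).symm := fun i => by
    rw [pow_succ', Equiv.Perm.mul_apply, ← P.facePerm_symm_apply, hface]
  have hspoke : ∀ i < (P.graph.neighborSet v).ncard, i ≠ 0 → i ≠ 2 →
      g ((P.rot ^ i) d).symm = g ((P.rot ^ i) d) := by
    intro i hi h0 h2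
    have := hoff ((P.rot ^ i) d).symm (hnv i) (hne hi (by omega) h0) (hne hi (by omega) h2)
    rw [Dart.symm_symm] at this
    exact this.symm
  have h2 : g ((P.rot ^ 2) d).symm = g ((P.rot ^ 2) d) + 1 := by
    have := hsymm ((P.rot ^ 2) d)
    rw [if_pos (Or.inr (Or.inr (by rw [Dart.edge, rot_pow_eq_mk]; exact Sym2.eq_swap)))] at this
    rw [← this, ← add_assoc, CharTwo.add_self_eq_zero, zero_add]
  have h3 : ∀ j, 3 ≤ j → j < (P.graph.neighborSet v).ncard →
      g ((P.rot ^ j) d) = g ((P.rot ^ 1) d) + 1 := by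
    intro j hj
    induction j, hj using Nat.le_induction with
    | base => intro h; rw [hrot 2, h2, hrot 1, hspoke 1 (by omega) (by omega) (by omega)]
    | succ j hj ih =>
      intro h
      rw [hrot j, hspoke j (by omega) (by omega) (by omega), ih (by omega)]
  have e1 : g ⟨(P.nbr d 1, P.nbr d k), h1k⟩ = g ((P.rot ^ 1) d) := by
    rw [← hspoke 1 (by omega) (by omega) (by omega)]
    exact hconst (P.nbr d 1) (hnv 1) (hne (by omega) (by omega) (by omega))
      (hne (by omega) (by omega) (by omega)) _ _ rfl rfl
  have e2 : g ⟨(P.nbr d k, P.nbr d 1), h1k.symm⟩ = g ((P.rot ^ k) d) := by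
    rw [← hspoke k (by omega) (by omega) (by omega)]
    exact hconst (P.nbr d k) (hnv k) (hne (by omega) (by omega) (by omega))
      (hne (by omega) (by omega) (by omega)) _ _ rfl rfl
  have e3 : g ⟨(P.nbr d k, P.nbr d 1), h1k.symm⟩ = g ⟨(P.nbr d 1, P.nbr d k), h1k⟩ :=
    hoff ⟨(P.nbr d 1, P.nbr d k), h1k⟩ (hnv 1) (hne (by omega) (by omega) (by omega))
      (hne (by omega) (by omega) (by omega))
  rw [e1, e2, h3 k hk hkd] at e3
  simp at e3

end Jordan

end RotationSystem

theorem SimpleGraph.natCard_dart {V : Type*} [Finite V] (G : SimpleGraph V) :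
    Nat.card G.Dart = 2 * Nat.card G.edgeSet := by
  classical
  have := Fintype.ofFinite V
  rw [Nat.card_eq_fintype_card, Nat.card_eq_fintype_card, G.dart_card_eq_twice_card_edges,
    ← SimpleGraph.edgeFinset_card]

namespace RotationSystem

section OfFaces

variable {V W : Type} [Fintype V] [DecidableEq V] [Fintype W] [DecidableEq W]
  (P : RotationSystem V) (H : SimpleGraph W) (hH : H.Connected) (K : P.graph.Dart → Prop)
  (hK : ∀ d, K (P.facePerm d) ↔ K d) (θ : {d // K d} ≃ H.Dart)

/-- The permutation of the darts of `H` transported from the face permutation of `P`. -/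
def transportedFacePerm : Equiv.Perm H.Dart := θ.permCongr (P.facePerm.subtypePerm hK)

omit [Fintype W] [DecidableEq W] in
theorem transportedFacePerm_apply (d : P.graph.Dart) (hd : K d) :
    P.transportedFacePerm H K hK θ (θ ⟨d, hd⟩) = θ ⟨P.facePerm d, (hK d).2 hd⟩ := by
  simp [transportedFacePerm, Equiv.permCongr_apply]

/-- The rotation at the tails of the darts of `H` determined by the transported faces. -/
def transportedRot : Equiv.Perm H.Dart :=
  (Function.Involutive.toPerm _ (Dart.symm_involutive (G := H))).trans
    (P.transportedFacePerm H K hK θ)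

omit [Fintype W] [DecidableEq W] in
theorem transportedRot_apply (d : H.Dart) :
    P.transportedRot H K hK θ d = P.transportedFacePerm H K hK θ d.symm := rfl

/-- The rotation system on `H` whose faces are the faces of `P` made of darts in `K`. -/
def ofFaces (hfst : ∀ d (hd : K d), (θ ⟨P.facePerm d, (hK d).2 hd⟩).fst = (θ ⟨d, hd⟩).snd)
    (horb : ∀ d e : H.Dart, d.fst = e.fst → (P.transportedRot H K hK θ).SameCycle d e) :
    RotationSystem W where
  graph := H
  conn := hH
  rot := P.transportedRot H K hK θ
  rot_fst d := by
    obtain ⟨⟨e, he⟩, h⟩ := θ.surjective d.symm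
    rw [transportedRot_apply, ← h, transportedFacePerm_apply _ _ _ _ _ _ he, hfst e he, h]
    rfl
  rot_orbit d e h := by
    obtain ⟨n, -, hn⟩ := (horb d e h).exists_pow_eq'
    exact ⟨n, hn⟩

variable (hfst : ∀ d (hd : K d), (θ ⟨P.facePerm d, (hK d).2 hd⟩).fst = (θ ⟨d, hd⟩).snd)
  (horb : ∀ d e : H.Dart, d.fst = e.fst → (P.transportedRot H K hK θ).SameCycle d e)

theorem ofFaces_facePerm :
    (P.ofFaces H hH K hK θ hfst horb).facePerm = P.transportedFacePerm H K hK θ := by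
  ext1 d
  exact congrArg _ d.symm_symm

theorem ofFaces_sameFace_iff (d e : {d // K d}) :
    (P.ofFaces H hH K hK θ hfst horb).SameFace (θ d) (θ e) ↔ P.SameFace d e := by
  have key : ∀ n : ℕ, ((P.transportedFacePerm H K hK θ) ^ n) (θ d) = θ e ↔
      (P.facePerm ^ n) d = e := by
    intro n
    have : ∀ n : ℕ, ∃ h, ((P.transportedFacePerm H K hK θ) ^ n) (θ d) =
        θ ⟨(P.facePerm ^ n) d, h⟩ := by
      intro n
      induction n with
      | zero => exact ⟨d.2, rfl⟩
      | succ n ih =>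
        obtain ⟨h, ih⟩ := ih
        have h' : K ((P.facePerm ^ (n + 1)) d) := by
          rw [pow_succ', Equiv.Perm.mul_apply]
          exact (hK _).2 h
        refine ⟨h', ?_⟩
        rw [pow_succ', Equiv.Perm.mul_apply, ih, transportedFacePerm_apply]
        exact congrArg θ (Subtype.ext (by
          change P.facePerm ((P.facePerm ^ n) d.1) = (P.facePerm ^ (n + 1)) d.1
          rw [pow_succ', Equiv.Perm.mul_apply]))
    obtain ⟨h, hn⟩ := this n
    rw [hn, θ.injective.eq_iff, Subtype.ext_iff]
  unfold SameFace
  rw [ofFaces_facePerm]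
  constructor
  · intro h
    obtain ⟨n, -, hn⟩ := Equiv.Perm.SameCycle.exists_pow_eq' h
    exact ⟨n, (key n).1 hn⟩
  · intro h
    obtain ⟨n, -, hn⟩ := Equiv.Perm.SameCycle.exists_pow_eq' h
    exact ⟨n, (key n).2 hn⟩

include hK in
theorem mem_of_sameFace {d e : P.graph.Dart} (hd : K d) (h : P.SameFace d e) : K e := by
  obtain ⟨n, -, rfl⟩ := Equiv.Perm.SameCycle.exists_pow_eq' h
  clear h
  induction n with
  | zero => exact hd
  | succ n ih => rw [pow_succ', Equiv.Perm.mul_apply]; exact (hK _).2 ih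

theorem ofFaces_faceSize (d : {d // K d}) :
    (P.ofFaces H hH K hK θ hfst horb).faceSize (θ d) = P.faceSize d := by
  symm
  refine Set.ncard_congr (fun e he => θ ⟨e, P.mem_of_sameFace K hK d.2 he⟩) ?_ ?_ ?_
  · intro e he
    exact (P.ofFaces_sameFace_iff H hH K hK θ hfst horb _ _).2 he
  · intro e e' _ _ h
    exact congrArg Subtype.val (θ.injective h)
  · intro e he
    obtain ⟨e, rfl⟩ := θ.surjective e
    exact ⟨e, (P.ofFaces_sameFace_iff H hH K hK θ hfst horb _ _).1 he, rfl⟩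

theorem ofFaces_numFaces : (P.ofFaces H hH K hK θ hfst horb).numFaces =
    {q : Quotient P.faceSetoid | ∃ d, K d ∧ Quotient.mk _ d = q}.ncard := by
  rw [numFaces, ← Set.ncard_univ]
  have hiff : ∀ e e' : H.Dart, (P.ofFaces H hH K hK θ hfst horb).SameFace e e' ↔
      P.SameFace (θ.symm e).1 (θ.symm e').1 := fun e e' => by
    rw [← P.ofFaces_sameFace_iff H hH K hK θ hfst horb, θ.apply_symm_apply, θ.apply_symm_apply]
  refine Set.ncard_congr (fun q _ => Quotient.liftOn q
    (fun e => Quotient.mk P.faceSetoid (θ.symm e).1) ?_) ?_ ?_ ?_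
  · intro e e' h
    exact Quotient.sound ((hiff e e').1 h)
  · intro q _
    induction q using Quotient.ind with | _ e
    exact ⟨_, (θ.symm e).2, rfl⟩
  · intro q q' _ _ h
    induction q using Quotient.ind with | _ e
    induction q' using Quotient.ind with | _ e'
    exact Quotient.sound ((hiff e e').2 (Quotient.exact h))
  · rintro _ ⟨d, hd, rfl⟩
    refine ⟨Quotient.mk _ (θ ⟨d, hd⟩), trivial, ?_⟩
    exact congrArg (fun e : {d // K d} => Quotient.mk P.faceSetoid e.1) (θ.symm_apply_apply _)

end OfFaces

end RotationSystem

/-- The simple graph obtained from `G` by deleting `v` and joining its neighbors to `c`. -/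
def SimpleGraph.mergeInto {V : Type*} (G : SimpleGraph V) (v c : V) :
    SimpleGraph {x // x ≠ v} where
  Adj x y := x ≠ y ∧ (G.Adj x y ∨ (x.1 = c ∧ G.Adj v y) ∨ (y.1 = c ∧ G.Adj v x))
  symm := ⟨fun x y ⟨h, h'⟩ => ⟨h.symm, by rw [G.adj_comm]; tauto⟩⟩
  loopless := ⟨fun x h => h.1 rfl⟩

section Retract

variable {V : Type*} [DecidableEq V] {v c : V} (hc : c ≠ v)

/-- The retraction of the vertex set onto the complement of `v` that sends `v` to `c`. -/
def vertexRetract (x : V) : {x // x ≠ v} := if h : x = v then ⟨c, hc⟩ else ⟨x, h⟩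

theorem vertexRetract_of_ne {x : V} (hx : x ≠ v) : vertexRetract hc x = ⟨x, hx⟩ := dif_neg hx

theorem vertexRetract_eq_iff (x y : V) : vertexRetract hc x = vertexRetract hc y ↔
    x = y ∨ (x = v ∧ y = c) ∨ (x = c ∧ y = v) := by
  unfold vertexRetract
  split_ifs <;> grind

theorem SimpleGraph.mergeInto_adj_vertexRetract {G : SimpleGraph V} {x y : V} (h : G.Adj x y)
    (h1 : ¬ (x = v ∧ y = c)) (h2 : ¬ (x = c ∧ y = v)) :
    (G.mergeInto v c).Adj (vertexRetract hc x) (vertexRetract hc y) := by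
  refine ⟨fun he => ?_, ?_⟩
  · rcases (vertexRetract_eq_iff hc x y).1 he with he | he | he
    · exact h.ne he
    · exact h1 he
    · exact h2 he
  · have := h.ne
    unfold vertexRetract
    split_ifs <;> simp_all [G.adj_comm]

include hc in
theorem SimpleGraph.Connected.mergeInto {G : SimpleGraph V} (hG : G.Connected) :
    (G.mergeInto v c).Connected := by
  have : Nonempty {x // x ≠ v} := ⟨⟨c, hc⟩⟩
  refine ⟨fun x y => ?_⟩
  have key : ∀ a b : V, G.Reachable a b →
      (G.mergeInto v c).Reachable (vertexRetract hc a) (vertexRetract hc b) := by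
    rintro a b ⟨w⟩
    induction w with
    | nil => exact Reachable.refl _
    | @cons a b _ hab _ ih =>
      refine Reachable.trans ?_ ih
      by_cases he : vertexRetract hc a = vertexRetract hc b
      · rw [he]
      · rw [vertexRetract_eq_iff] at he
        exact (mergeInto_adj_vertexRetract hc hab (by tauto) (by tauto)).reachable
  have := key x y (hG.preconnected x y)
  rwa [vertexRetract_of_ne hc x.2, vertexRetract_of_ne hc y.2] at this

end Retract

namespace RotationSystem

section Contraction

variable {V : Type} [Fintype V] [DecidableEq V] {P : RotationSystem V} {d₀ : P.graph.Dart}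

/-- The tail of `d₀` has degree at least three and only triangular faces, and it has only two
common neighbors with the head of `d₀`, namely the ones next to `d₀` in the rotation. -/
structure Contractible (P : RotationSystem V) (d₀ : P.graph.Dart) : Prop where
  inner : P.IsInner d₀.fst
  three_le : 3 ≤ (P.graph.neighborSet d₀.fst).ncard
  not_adj : ∀ i, 2 ≤ i → i + 2 ≤ (P.graph.neighborSet d₀.fst).ncard →
    ¬ P.graph.Adj d₀.snd (P.nbr d₀ i)

/-- The darts on neither of the two faces at the edge of `d₀`. -/
def Kept (d₀ d : P.graph.Dart) : Prop := ¬ P.SameFace d₀ d ∧ ¬ P.SameFace d₀.symm d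

theorem kept_facePerm (d : P.graph.Dart) : Kept d₀ (P.facePerm d) ↔ Kept d₀ d :=
  and_congr (not_congr Equiv.Perm.sameCycle_apply_right)
    (not_congr Equiv.Perm.sameCycle_apply_right)

/-- The head of the dart preceding `d₀` in the rotation. -/
def prevNbr (P : RotationSystem V) (d₀ : P.graph.Dart) : V := (P.rot.symm d₀).snd

theorem rot_symm_toProd : (P.rot.symm d₀).toProd = (d₀.fst, P.prevNbr d₀) := by
  refine Prod.ext ?_ rfl
  rw [← P.rot_fst, P.rot.apply_symm_apply]

theorem nbr_zero : P.nbr d₀ 0 = d₀.snd := rfl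

theorem rot_toProd : (P.rot d₀).toProd = (d₀.fst, P.nbr d₀ 1) := Prod.ext (P.rot_fst _) rfl

theorem pow_pred_eq_rot_symm (h : 1 ≤ (P.graph.neighborSet d₀.fst).ncard) :
    (P.rot ^ ((P.graph.neighborSet d₀.fst).ncard - 1)) d₀ = P.rot.symm d₀ := by
  rw [Equiv.eq_symm_apply, ← Equiv.Perm.mul_apply, ← pow_succ', Nat.sub_add_cancel h]
  refine Dart.ext _ _ ?_
  rw [rot_pow_eq_mk, (P.nbr_eq_nbr_iff d₀ _ 0).2 (by simp [Nat.ModEq])]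
  rfl

namespace Contractible

variable (h : P.Contractible d₀)
include h

theorem nbr_pred : P.nbr d₀ ((P.graph.neighborSet d₀.fst).ncard - 1) = P.prevNbr d₀ := by
  rw [nbr, pow_pred_eq_rot_symm (by have := h.three_le; omega), prevNbr]

theorem nbr_one_ne_prevNbr : P.nbr d₀ 1 ≠ P.prevNbr d₀ := by
  have := h.three_le
  rw [← h.nbr_pred]
  intro he
  have := P.nbr_injOn d₀ (by omega) (by omega) he
  omega

theorem adj_snd_nbr_one : P.graph.Adj d₀.snd (P.nbr d₀ 1) := h.inner.adj_nbr_succ rfl 0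

theorem adj_prevNbr : P.graph.Adj d₀.fst (P.prevNbr d₀) := by
  rw [← h.nbr_pred]
  exact P.adj_nbr _ _

theorem adj_snd_prevNbr : P.graph.Adj d₀.snd (P.prevNbr d₀) := by
  have := h.inner.adj_rot (d := P.rot.symm d₀) (by rw [rot_symm_toProd])
  rwa [P.rot.apply_symm_apply] at this

theorem eq_or_eq_of_common {x : V} (h1 : P.graph.Adj d₀.fst x) (h2 : P.graph.Adj d₀.snd x) :
    x = P.nbr d₀ 1 ∨ x = P.prevNbr d₀ := by
  obtain ⟨i, hi, rfl⟩ := P.exists_nbr_eq d₀ h1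
  by_cases h0 : i = 0
  · subst h0
    exact absurd h2 (P.graph.irrefl)
  by_cases h1 : i = 1
  · exact Or.inl (by rw [h1])
  by_cases hl : i = (P.graph.neighborSet d₀.fst).ncard - 1
  · exact Or.inr (by rw [hl, h.nbr_pred])
  · exact absurd h2 (h.not_adj i (by omega) (by omega))

theorem facePerm_toProd : (P.facePerm d₀).toProd = (d₀.snd, P.prevNbr d₀) := by
  have := h.inner.facePerm_rot (d := P.rot.symm d₀) (by rw [rot_symm_toProd])
  rwa [P.rot.apply_symm_apply] at this

theorem facePerm_facePerm : P.facePerm (P.facePerm d₀) = (P.rot.symm d₀).symm := by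
  have := h.inner.facePerm_facePerm_rot (d := P.rot.symm d₀) (by rw [rot_symm_toProd])
  rwa [P.rot.apply_symm_apply] at this

theorem facePerm_rot_toProd : (P.facePerm (P.rot d₀)).toProd = (P.nbr d₀ 1, d₀.snd) :=
  h.inner.facePerm_rot rfl

theorem sameFace_iff (d : P.graph.Dart) : P.SameFace d₀ d ↔ d = d₀ ∨
    d.toProd = (d₀.snd, P.prevNbr d₀) ∨ d.toProd = (P.prevNbr d₀, d₀.fst) := by
  rw [P.sameFace_iff_of_faceSize (h.inner d₀ rfl), h.facePerm_facePerm, Dart.ext_iff, Dart.ext_iff,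
    Dart.ext_iff, h.facePerm_toProd, Dart.symm_toProd, rot_symm_toProd, Prod.swap_prod_mk]

theorem sameFace_symm_iff (d : P.graph.Dart) : P.SameFace d₀.symm d ↔ d = d₀.symm ∨
    d.toProd = (d₀.fst, P.nbr d₀ 1) ∨ d.toProd = (P.nbr d₀ 1, d₀.snd) := by
  have h1 : P.SameFace d₀.symm d ↔ P.SameFace (P.rot d₀) d := by
    rw [← P.facePerm_symm_apply]
    exact Equiv.Perm.sameCycle_apply_left.symm
  rw [h1, P.sameFace_iff_of_faceSize (h.inner _ (P.rot_fst d₀)),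
    h.inner.facePerm_facePerm_rot rfl, Dart.ext_iff, Dart.ext_iff,
    Dart.ext_iff, h.facePerm_rot_toProd, rot_toProd]
  tauto

theorem kept_iff (d : P.graph.Dart) : Kept d₀ d ↔
    d.toProd ≠ (d₀.fst, d₀.snd) ∧ d.toProd ≠ (d₀.snd, P.prevNbr d₀) ∧
    d.toProd ≠ (P.prevNbr d₀, d₀.fst) ∧ d.toProd ≠ (d₀.snd, d₀.fst) ∧
    d.toProd ≠ (d₀.fst, P.nbr d₀ 1) ∧ d.toProd ≠ (P.nbr d₀ 1, d₀.snd) := by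
  rw [Kept, h.sameFace_iff, h.sameFace_symm_iff, Dart.ext_iff, Dart.ext_iff, Dart.symm_toProd]
  tauto

end Contractible

/-- The dart of the contracted graph represented by a dart other than `d₀` and its reverse. -/
def mergeDart (d₀ d : P.graph.Dart) (h₁ : d ≠ d₀) (h₂ : d ≠ d₀.symm) :
    (P.graph.mergeInto d₀.fst d₀.snd).Dart :=
  ⟨(vertexRetract d₀.snd_ne_fst d.fst, vertexRetract d₀.snd_ne_fst d.snd),
    SimpleGraph.mergeInto_adj_vertexRetract _ d.adj
      (fun h => h₁ (Dart.ext _ _ (Prod.ext h.1 h.2)))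
      (fun h => h₂ (Dart.ext _ _ (Prod.ext h.1 h.2)))⟩

theorem Kept.ne {d : P.graph.Dart} (hd : Kept d₀ d) : d ≠ d₀ := by
  rintro rfl
  exact hd.1 (Equiv.Perm.SameCycle.refl _ _)

theorem Kept.ne_symm {d : P.graph.Dart} (hd : Kept d₀ d) : d ≠ d₀.symm := by
  rintro rfl
  exact hd.2 (Equiv.Perm.SameCycle.refl _ _)

/-- The map from kept darts to darts of the contracted graph. -/
def keptDart (d : {d // Kept d₀ d}) : (P.graph.mergeInto d₀.fst d₀.snd).Dart :=
  mergeDart d₀ d.1 d.2.ne d.2.ne_symm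

theorem keptDart_injective (h : P.Contractible d₀) :
    Function.Injective (keptDart (d₀ := d₀)) := by
  rintro ⟨d, hd⟩ ⟨e, he⟩ hde
  have h1 := (vertexRetract_eq_iff _ _ _).1 (congrArg (fun d => d.fst) hde)
  have h2 := (vertexRetract_eq_iff _ _ _).1 (congrArg (fun d => d.snd) hde)
  rw [h.kept_iff] at hd he
  obtain ⟨⟨x, y⟩, hxy⟩ := d
  obtain ⟨⟨x', y'⟩, hxy'⟩ := e
  have hv := @h.eq_or_eq_of_common
  simp only [ne_eq, Prod.mk.injEq] at hd he h1 h2 hxy hxy'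
  simp only [Subtype.mk.injEq, Dart.mk.injEq, Prod.mk.injEq]
  have hs := fun a b => P.graph.adj_comm a b
  have hi := fun a => P.graph.irrefl (v := a)
  grind

theorem keptDart_surjective (h : P.Contractible d₀) :
    Function.Surjective (keptDart (d₀ := d₀)) := by
  rintro ⟨⟨⟨x, hx⟩, ⟨y, hy⟩⟩, hxy, hadj⟩
  suffices ∃ d : P.graph.Dart, Kept d₀ d ∧ vertexRetract d₀.snd_ne_fst d.fst = ⟨x, hx⟩ ∧
      vertexRetract d₀.snd_ne_fst d.snd = ⟨y, hy⟩ by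
    obtain ⟨d, hd, h1, h2⟩ := this
    exact ⟨⟨d, hd⟩, Dart.ext _ _ (Prod.ext h1 h2)⟩
  have key : ∀ a b, ∀ hab : P.graph.Adj a b, Kept d₀ ⟨(a, b), hab⟩ →
      (a = x ∨ (a = d₀.fst ∧ x = d₀.snd)) → (b = y ∨ (b = d₀.fst ∧ y = d₀.snd)) →
      ∃ d : P.graph.Dart, Kept d₀ d ∧ vertexRetract d₀.snd_ne_fst d.fst = ⟨x, hx⟩ ∧
      vertexRetract d₀.snd_ne_fst d.snd = ⟨y, hy⟩ := by
    intro a b hab hk ha hb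
    refine ⟨_, hk, ?_, ?_⟩
    · rw [← vertexRetract_of_ne d₀.snd_ne_fst hx, vertexRetract_eq_iff]; tauto
    · rw [← vertexRetract_of_ne d₀.snd_ne_fst hy, vertexRetract_eq_iff]; tauto
  simp only [h.kept_iff, ne_eq, Prod.mk.injEq] at key ⊢
  have hcv := d₀.snd_ne_fst
  have h1 := h.nbr_one_ne_prevNbr
  have h2 := h.adj_snd_nbr_one
  have h3 := h.adj_snd_prevNbr
  have h4 := h.adj_prevNbr
  have h5 := P.adj_nbr d₀ 1
  have hxy : x ≠ y := fun h => hxy (Subtype.ext h)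
  simp only at hadj
  have e2 := h2.ne
  have e3 := h3.ne
  have e4 := h4.ne
  have e5 := h5.ne
  by_cases hcm : x = d₀.snd ∧ y = P.prevNbr d₀
  · exact key _ _ h4 (by grind) (by grind) (by grind)
  by_cases hac : x = P.nbr d₀ 1 ∧ y = d₀.snd
  · exact key _ _ h5.symm (by grind) (by grind) (by grind)
  by_cases hca : x = d₀.snd ∧ y = P.nbr d₀ 1
  · exact key _ _ h2 (by grind) (by grind) (by grind)
  by_cases hmc : x = P.prevNbr d₀ ∧ y = d₀.snd
  · exact key _ _ h3.symm (by grind) (by grind) (by grind)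
  rcases hadj with hadj | ⟨hadj, hadj'⟩ | ⟨hadj, hadj'⟩
  · exact key _ _ hadj (by grind) (by grind) (by grind)
  · exact key _ _ hadj' (by grind) (by grind) (by grind)
  · exact key _ _ hadj'.symm (by grind) (by grind) (by grind)

end Contraction

end RotationSystem

namespace RotationSystem

section Contraction

variable {V : Type} [Fintype V] [DecidableEq V] {P : RotationSystem V} {d₀ : P.graph.Dart}

theorem mergeDart_eq_mergeDart_iff {d e : P.graph.Dart} (h₁ : d ≠ d₀) (h₂ : d ≠ d₀.symm)
    (h₃ : e ≠ d₀) (h₄ : e ≠ d₀.symm) : mergeDart d₀ d h₁ h₂ = mergeDart d₀ e h₃ h₄ ↔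
      vertexRetract d₀.snd_ne_fst d.fst = vertexRetract d₀.snd_ne_fst e.fst ∧
      vertexRetract d₀.snd_ne_fst d.snd = vertexRetract d₀.snd_ne_fst e.snd := by
  rw [Dart.ext_iff, Prod.ext_iff]
  rfl

theorem mergeDart_congr {d e : P.graph.Dart} (h₁ : d ≠ d₀) (h₂ : d ≠ d₀.symm) (h : d = e) :
    mergeDart d₀ d h₁ h₂ = mergeDart d₀ e (h ▸ h₁) (h ▸ h₂) := by
  subst h
  rfl

namespace Contractible

variable (h : P.Contractible d₀)

/-- The kept darts correspond to the darts of the contracted graph. -/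
noncomputable def dartEquiv : {d // Kept d₀ d} ≃ (P.graph.mergeInto d₀.fst d₀.snd).Dart :=
  Equiv.ofBijective keptDart ⟨keptDart_injective h, keptDart_surjective h⟩

/-- The rotation of the contracted graph. -/
noncomputable def mergeRot : Equiv.Perm (P.graph.mergeInto d₀.fst d₀.snd).Dart :=
  P.transportedRot _ (Kept d₀) kept_facePerm h.dartEquiv

theorem mergeRot_mergeDart (d : P.graph.Dart) (hd : Kept d₀ d.symm) (h₁ : d ≠ d₀)
    (h₂ : d ≠ d₀.symm) (h₃ : P.rot d ≠ d₀) (h₄ : P.rot d ≠ d₀.symm) :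
    h.mergeRot (mergeDart d₀ d h₁ h₂) = mergeDart d₀ (P.rot d) h₃ h₄ := by
  have h1 : (mergeDart d₀ d h₁ h₂).symm = h.dartEquiv ⟨d.symm, hd⟩ := Dart.ext _ _ rfl
  rw [mergeRot, transportedRot_apply, h1, transportedFacePerm_apply]
  exact (mergeDart_congr h₃ h₄ (P.facePerm_symm_apply d).symm).symm

include h in
theorem rot_ne : P.rot d₀ ≠ d₀ := by
  intro he
  have := h.adj_snd_nbr_one
  rw [nbr, pow_one, he] at this
  exact P.graph.irrefl this

theorem rot_ne_symm : P.rot d₀ ≠ d₀.symm := by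
  intro he
  have := P.rot_fst d₀
  rw [he] at this
  exact d₀.snd_ne_fst this

theorem facePerm_ne : P.facePerm d₀ ≠ d₀ := by
  intro he
  have := P.facePerm_fst d₀
  rw [he] at this
  exact d₀.snd_ne_fst this.symm

include h in
theorem facePerm_ne_symm : P.facePerm d₀ ≠ d₀.symm := by
  intro he
  have := congrArg Prod.snd h.facePerm_toProd
  rw [he] at this
  exact h.adj_prevNbr.ne this

/-- The image of a dart in the contracted graph, where the contracted edge is replaced by the
next dart in the rotation. -/
noncomputable def image (d : P.graph.Dart) : (P.graph.mergeInto d₀.fst d₀.snd).Dart :=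
  if h₁ : d = d₀ then mergeDart d₀ (P.rot d₀) h.rot_ne rot_ne_symm
  else if h₂ : d = d₀.symm then mergeDart d₀ (P.facePerm d₀) facePerm_ne h.facePerm_ne_symm
  else mergeDart d₀ d h₁ h₂

theorem image_of_ne {d : P.graph.Dart} (h₁ : d ≠ d₀) (h₂ : d ≠ d₀.symm) :
    h.image d = mergeDart d₀ d h₁ h₂ := by
  rw [image, dif_neg h₁, dif_neg h₂]

theorem image_self : h.image d₀ = h.image (P.rot d₀) := by
  rw [h.image_of_ne h.rot_ne rot_ne_symm, image, dif_pos rfl]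

theorem image_symm : h.image d₀.symm = h.image (P.facePerm d₀) := by
  rw [h.image_of_ne facePerm_ne h.facePerm_ne_symm, image, dif_neg d₀.symm_ne, dif_pos rfl]

theorem mergeRot_image {d : P.graph.Dart} (hd : Kept d₀ d.symm) :
    h.mergeRot (h.image d) = h.image (P.rot d) := by
  have h1 : d ≠ d₀ := by
    rintro rfl
    exact hd.2 (Equiv.Perm.SameCycle.refl _ _)
  have h2 : d ≠ d₀.symm := by
    rintro rfl
    rw [Dart.symm_symm] at hd
    exact hd.1 (Equiv.Perm.SameCycle.refl _ _)
  have hr : Kept d₀ (P.rot d) := by rwa [← P.facePerm_symm_apply, kept_facePerm]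
  rw [h.image_of_ne h1 h2, h.image_of_ne hr.ne hr.ne_symm, h.mergeRot_mergeDart d hd]

theorem sameCycle_image_rot_symm :
    h.mergeRot.SameCycle (h.image (P.rot d₀)) (h.image (P.rot.symm d₀)) := by
  have h3 := h.three_le
  rw [← pow_pred_eq_rot_symm (by omega)]
  suffices ∀ i, 1 ≤ i → i + 1 ≤ (P.graph.neighborSet d₀.fst).ncard →
      h.mergeRot.SameCycle (h.image (P.rot d₀)) (h.image ((P.rot ^ i) d₀)) from
    this _ (by omega) (by omega)
  intro i hi
  induction i, hi using Nat.le_induction with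
  | base => exact fun _ => Equiv.Perm.SameCycle.refl _ _
  | succ i hi ih =>
    intro hi'
    refine (ih (by omega)).trans ?_
    rw [pow_succ', Equiv.Perm.mul_apply, ← h.mergeRot_image]
    · exact ⟨1, rfl⟩
    · have hm : P.nbr d₀ i ≠ P.prevNbr d₀ := by
        rw [← h.nbr_pred]
        intro he
        have := P.nbr_injOn d₀ (by omega) (by omega) he
        omega
      have hc : P.nbr d₀ i ≠ d₀.snd := by
        rw [← nbr_zero]
        intro he
        have := P.nbr_injOn d₀ (by omega) (by omega) he
        omega
      have e1 := (P.adj_nbr d₀ i).ne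
      have e2 := h.adj_prevNbr.ne
      have e3 := d₀.fst_ne_snd
      rw [h.kept_iff, Dart.symm_toProd, rot_pow_eq_mk, Prod.swap_prod_mk]
      simp only [ne_eq, Prod.mk.injEq]
      grind

theorem sameCycle_image_rot (d : P.graph.Dart) :
    h.mergeRot.SameCycle (h.image d) (h.image (P.rot d)) := by
  by_cases h1 : d = d₀
  · rw [h1, h.image_self]
  by_cases h2 : d = d₀.symm
  · rw [h2, h.image_symm]
    rfl
  by_cases hk : Kept d₀ d.symm
  · rw [← h.mergeRot_image hk]
    exact ⟨1, rfl⟩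
  have hsnd : d.snd ≠ d.fst := d.snd_ne_fst
  have hsymm : ∀ e : P.graph.Dart, d.symm = e → P.rot d = P.facePerm e := by
    rintro e rfl
    exact (P.facePerm_symm_apply d).symm
  have hmc := h.adj_snd_prevNbr.ne
  have hmv := h.adj_prevNbr.ne
  have hac := h.adj_snd_nbr_one.ne
  have hav := (P.adj_nbr d₀ 1).ne
  have hcv := d₀.fst_ne_snd
  have hs : d.symm = P.facePerm d₀ ∨ d.symm = (P.rot.symm d₀).symm ∨ d.symm = P.rot d₀ ∨
      d.symm = P.facePerm (P.rot d₀) := by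
    have h1' : d.symm.toProd ≠ (d₀.snd, d₀.fst) := fun he =>
      h1 (Dart.symm_involutive.injective (Dart.ext _ _ he))
    have h2' : d.symm.toProd ≠ (d₀.fst, d₀.snd) := fun he =>
      h2 (by rw [← Dart.ext _ d₀ he, Dart.symm_symm])
    rw [h.kept_iff] at hk
    rw [Dart.ext_iff, Dart.ext_iff, Dart.ext_iff, Dart.ext_iff, h.facePerm_toProd, rot_toProd,
      h.facePerm_rot_toProd, Dart.symm_toProd (P.rot.symm d₀), rot_symm_toProd, Prod.swap_prod_mk]
    tauto
  have hd : ∀ e : P.graph.Dart, d.symm = e → d = e.symm := by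
    rintro e rfl
    exact d.symm_symm.symm
  have key : ∀ e e' : P.graph.Dart, e ≠ d₀ → e ≠ d₀.symm → e' ≠ d₀ → e' ≠ d₀.symm →
      (e.fst = e'.fst ∨ (e.fst = d₀.fst ∧ e'.fst = d₀.snd) ∨ (e.fst = d₀.snd ∧ e'.fst = d₀.fst)) →
      (e.snd = e'.snd ∨ (e.snd = d₀.fst ∧ e'.snd = d₀.snd) ∨ (e.snd = d₀.snd ∧ e'.snd = d₀.fst)) →
      h.image e = h.image e' := by
    intro e e' a1 a2 a3 a4 a5 a6
    rw [h.image_of_ne a1 a2, h.image_of_ne a3 a4, mergeDart_eq_mergeDart_iff,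
      vertexRetract_eq_iff, vertexRetract_eq_iff]
    exact ⟨a5, a6⟩
  have ext_ne : ∀ e e' : P.graph.Dart, ¬ (e.fst = e'.fst ∧ e.snd = e'.snd) → e ≠ e' := by
    rintro e _ he rfl
    exact he ⟨rfl, rfl⟩
  have f1 := Prod.ext_iff.1 (@rot_toProd V _ _ P d₀)
  have f2 := Prod.ext_iff.1 h.facePerm_toProd
  have f3 := Prod.ext_iff.1 (@rot_symm_toProd V _ _ P d₀)
  have f4 := Prod.ext_iff.1 h.facePerm_rot_toProd
  simp only at f1 f2 f3 f4
  have s1 : ∀ e : P.graph.Dart, e.symm.fst = e.snd := fun _ => rfl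
  have s2 : ∀ e : P.graph.Dart, e.symm.snd = e.fst := fun _ => rfl
  rcases hs with hs | hs | hs | hs
  · rw [hsymm _ hs, hd _ hs, h.facePerm_facePerm, key (P.facePerm d₀).symm (P.rot.symm d₀).symm]
    all_goals first | (apply ext_ne; grind) | grind
  · rw [hsymm _ hs, hd _ hs, ← hsymm _ hs, hd _ hs, Dart.symm_symm, P.rot.apply_symm_apply,
      h.image_self]
    exact h.sameCycle_image_rot_symm.symm
  · rw [hsymm _ hs, hd _ hs, key (P.rot d₀).symm (P.facePerm (P.rot d₀))]
    all_goals first | (apply ext_ne; grind) | grind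
  · rw [hsymm _ hs, hd _ hs, h.inner.facePerm_facePerm_rot rfl, h.image_symm,
      key (P.facePerm (P.rot d₀)).symm (P.rot d₀), key (P.facePerm d₀) (P.rot.symm d₀)]
    on_goal 1 => exact h.sameCycle_image_rot_symm
    all_goals first | (apply ext_ne; grind) | grind

theorem sameCycle_image_of_fst_eq {d e : P.graph.Dart} (hde : d.fst = e.fst) :
    h.mergeRot.SameCycle (h.image d) (h.image e) := by
  obtain ⟨n, rfl⟩ := P.rot_orbit d e hde
  clear hde
  induction n with
  | zero => rfl
  | succ n ih =>
    rw [pow_succ', Equiv.Perm.mul_apply]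
    exact ih.trans (h.sameCycle_image_rot _)

theorem sameCycle_mergeRot (d e : (P.graph.mergeInto d₀.fst d₀.snd).Dart) (hde : d.fst = e.fst) :
    h.mergeRot.SameCycle d e := by
  obtain ⟨⟨d, hd⟩, rfl⟩ := h.dartEquiv.surjective d
  obtain ⟨⟨e, he⟩, rfl⟩ := h.dartEquiv.surjective e
  have him : ∀ f (hf : Kept d₀ f), h.dartEquiv ⟨f, hf⟩ = h.image f := fun f hf =>
    (h.image_of_ne hf.ne hf.ne_symm).symm
  rw [him, him]
  have bridge : h.mergeRot.SameCycle (h.image d₀) (h.image d₀.symm) := by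
    have h1 : h.image (P.rot d₀) = h.image (P.facePerm (P.rot d₀)).symm := by
      have f1 := Prod.ext_iff.1 (@rot_toProd V _ _ P d₀)
      have f4 := Prod.ext_iff.1 h.facePerm_rot_toProd
      have hac := h.adj_snd_nbr_one.ne
      have hav := (P.adj_nbr d₀ 1).ne
      simp only at f1 f4
      have g1 : (P.facePerm (P.rot d₀)).symm ≠ d₀ := by
        intro he
        have := congrArg (fun d : P.graph.Dart => d.fst) he
        exact d₀.snd_ne_fst (f4.2.symm.trans this)
      have g2 : (P.facePerm (P.rot d₀)).symm ≠ d₀.symm := by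
        intro he
        have := congrArg (fun d : P.graph.Dart => d.snd) he
        exact hav.symm (f4.1.symm.trans this)
      rw [h.image_of_ne h.rot_ne rot_ne_symm, h.image_of_ne g1 g2, mergeDart_eq_mergeDart_iff,
        vertexRetract_eq_iff, vertexRetract_eq_iff]
      exact ⟨Or.inr (Or.inl ⟨f1.1, f4.2⟩), Or.inl (f1.2.trans f4.1.symm)⟩
    rw [h.image_self, h1]
    exact h.sameCycle_image_of_fst_eq (e := d₀.symm) (Prod.ext_iff.1 h.facePerm_rot_toProd).2
  rcases (vertexRetract_eq_iff _ _ _).1 hde with hde | ⟨h1, h2⟩ | ⟨h1, h2⟩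
  · exact h.sameCycle_image_of_fst_eq hde
  · exact ((h.sameCycle_image_of_fst_eq h1).trans bridge).trans
      (h.sameCycle_image_of_fst_eq h2.symm)
  · exact ((h.sameCycle_image_of_fst_eq (e := d₀.symm) h1).trans bridge.symm).trans
      (h.sameCycle_image_of_fst_eq h2.symm)

theorem dartEquiv_facePerm_fst (d : P.graph.Dart) (hd : Kept d₀ d) :
    (h.dartEquiv ⟨P.facePerm d, (kept_facePerm d).2 hd⟩).fst = (h.dartEquiv ⟨d, hd⟩).snd :=
  congrArg (vertexRetract d₀.snd_ne_fst) (P.facePerm_fst d)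

/-- The rotation system obtained by contracting the edge of `d₀` into its head. -/
noncomputable def contract : RotationSystem {x // x ≠ d₀.fst} :=
  P.ofFaces (P.graph.mergeInto d₀.fst d₀.snd) (P.conn.mergeInto d₀.snd_ne_fst) (Kept d₀)
    kept_facePerm h.dartEquiv h.dartEquiv_facePerm_fst h.sameCycle_mergeRot

theorem contract_sameFace_iff (d e : {d // Kept d₀ d}) :
    h.contract.SameFace (h.dartEquiv d) (h.dartEquiv e) ↔ P.SameFace d e :=
  ofFaces_sameFace_iff ..

theorem contract_faceSize (d : {d // Kept d₀ d}) :
    h.contract.faceSize (h.dartEquiv d) = P.faceSize d :=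
  ofFaces_faceSize ..

include h in
theorem not_sameFace_symm : ¬ P.SameFace d₀ d₀.symm := by
  have h1 := d₀.fst_ne_snd
  have h2 := h.adj_prevNbr.ne
  have h3 := h.adj_snd_prevNbr.ne
  rw [h.sameFace_iff, Dart.symm_toProd]
  rintro (he | he | he)
  · exact d₀.symm_ne he
  · exact h2 (congrArg Prod.snd he)
  · exact h3 (congrArg Prod.fst he)

theorem contract_numFaces : h.contract.numFaces + 2 = P.numFaces := by
  have h1 : {q : Quotient P.faceSetoid | ∃ d, Kept d₀ d ∧ Quotient.mk _ d = q} =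
      {Quotient.mk P.faceSetoid d₀, Quotient.mk P.faceSetoid d₀.symm}ᶜ := by
    ext q
    induction q using Quotient.ind with | _ e
    simp only [Set.mem_ofPred_eq, Set.mem_compl_iff, Set.mem_insert_iff, Set.mem_singleton_iff,
      Quotient.eq]
    constructor
    · rintro ⟨d, hd, hde⟩ (h1 | h1)
      · exact hd.1 (h1.symm.trans hde.symm)
      · exact hd.2 (h1.symm.trans hde.symm)
    · intro h1
      exact ⟨e, ⟨fun h2 => h1 (Or.inl h2.symm), fun h2 => h1 (Or.inr h2.symm)⟩,
        Equiv.Perm.SameCycle.refl _ _⟩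
  have h2 : ({Quotient.mk P.faceSetoid d₀, Quotient.mk P.faceSetoid d₀.symm} :
      Set (Quotient P.faceSetoid)).ncard = 2 :=
    Set.ncard_pair fun he => h.not_sameFace_symm (Quotient.exact he)
  have h3 : h.contract.numFaces =
      {q : Quotient P.faceSetoid | ∃ d, Kept d₀ d ∧ Quotient.mk _ d = q}.ncard :=
    ofFaces_numFaces ..
  rw [h3, h1, numFaces, ← h2]
  exact Set.ncard_compl_add_ncard _

include h in
theorem card_dart_mergeInto :
    Nat.card (P.graph.mergeInto d₀.fst d₀.snd).Dart + 6 = Nat.card P.graph.Dart := by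
  have h1 : {d | Kept d₀ d} = ({e | P.SameFace d₀ e} ∪ {e | P.SameFace d₀.symm e})ᶜ := by
    ext d
    exact not_or.symm
  have h2 : P.faceSize d₀.symm = 3 := by
    rw [← h.inner (P.rot d₀) (P.rot_fst d₀), ← P.facePerm_symm_apply, faceSize, faceSize]
    congr 1
    ext e
    exact Equiv.Perm.sameCycle_apply_left.symm
  have h3 : ({e | P.SameFace d₀ e} ∪ {e | P.SameFace d₀.symm e}).ncard = 6 := by
    rw [Set.ncard_union_eq]
    · exact congrArg₂ (· + ·) (h.inner d₀ rfl) h2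
    · rw [Set.disjoint_left]
      exact fun e h4 h5 => h.not_sameFace_symm (Equiv.Perm.SameCycle.trans h4 h5.symm)
  rw [← Nat.card_congr h.dartEquiv, ← h3]
  change Nat.card {d | Kept d₀ d} + _ = _
  rw [Nat.card_coe_set_eq, h1]
  exact Set.ncard_compl_add_ncard _

theorem contract_isPlane (hP : P.IsPlane) : h.contract.IsPlane := by
  have h1 := h.contract_numFaces
  have h2 := h.card_dart_mergeInto
  have h3 : Fintype.card {x // x ≠ d₀.fst} + 1 = Fintype.card V := by
    have : 0 < Fintype.card V := Fintype.card_pos_iff.2 ⟨d₀.fst⟩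
    have h4 := Fintype.card_subtype_compl (fun x => x = d₀.fst)
    rw [Fintype.card_subtype_eq] at h4
    have h5 : Fintype.card {x // x ≠ d₀.fst} = Fintype.card {x // ¬ x = d₀.fst} := rfl
    omega
  rw [SimpleGraph.natCard_dart, SimpleGraph.natCard_dart] at h2
  unfold IsPlane at hP ⊢
  change _ - (Nat.card (P.graph.mergeInto d₀.fst d₀.snd).edgeSet : ℤ) + _ = _
  omega

end Contractible

end Contraction

end RotationSystem

/-- Contracting an edge at an inner vertex of a near-triangulation whose ends have only two common
neighbors gives a near-triangulation. -/
theorem NearTriangulation.exists_contract {V : Type} [Fintype V] [DecidableEq V]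
    (P : NearTriangulation V) {d₀ : P.graph.Dart} (hv : ¬ P.OnOuter d₀.fst)
    (h : P.toRotationSystem.Contractible d₀) :
    ∃ Q : NearTriangulation {x // x ≠ d₀.fst}, Q.graph = P.graph.mergeInto d₀.fst d₀.snd := by
  have hK : RotationSystem.Kept d₀ P.outer :=
    ⟨fun h1 => P.not_sameFace_outer hv d₀ (Or.inl rfl) h1.symm,
      fun h1 => P.not_sameFace_outer hv d₀.symm (Or.inr rfl) h1.symm⟩
  refine ⟨{ toRotationSystem := h.contract
            outer := h.dartEquiv ⟨P.outer, hK⟩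
            plane := h.contract_isPlane P.plane
            bounded_tri := fun d hd => ?_ }, rfl⟩
  obtain ⟨⟨d, hd'⟩, rfl⟩ := h.dartEquiv.surjective d
  rw [h.contract_faceSize]
  exact P.bounded_tri d fun h' => hd ((h.contract_sameFace_iff ⟨P.outer, hK⟩ ⟨d, hd'⟩).2 h')

section Coloring

variable {V : Type} {G : SimpleGraph V} {v c : V} {L : V → Finset ℕ} {ψ : V → ℕ}

theorem exists_isDynColoring_of_card_le [Fintype V] (hcard : Fintype.card V ≤ 6)
    (hL : ∀ x, 6 ≤ (L x).card) (r : ℕ) :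
    ∃ φ : V → ℕ, (∀ x, φ x ∈ L x) ∧ IsDynColoring G r φ := by
  classical
  obtain ⟨φ, hφ, hφL⟩ := (Finset.all_card_le_biUnion_card_iff_exists_injective L).1 fun s => by
    rcases s.eq_empty_or_nonempty with rfl | ⟨x, hx⟩
    · simp
    · calc s.card ≤ 6 := s.card_le_univ.trans hcard
        _ ≤ (L x).card := hL x
        _ ≤ (s.biUnion L).card := Finset.card_le_card (Finset.subset_biUnion_of_mem L hx)
  refine ⟨φ, hφL, fun x y h he => h.ne (hφ he), fun x => ?_⟩
  rw [Set.ncard_image_of_injective _ hφ]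
  exact min_le_right _ _

/-- The properties of a `3`-dynamic coloring of `G.mergeInto v c` that are used to extend it
to a coloring of `G`. -/
structure IsReducedColoring (G : SimpleGraph V) (v c : V) (L : V → Finset ℕ) (ψ : V → ℕ) :
    Prop where
  mem : ∀ x, x ≠ v → ψ x ∈ L x
  ne : ∀ x y, x ≠ v → y ≠ v → G.Adj x y → ψ x ≠ ψ y
  ne_center : ∀ x, G.Adj v x → x ≠ c → ψ x ≠ ψ c
  dyn : ∀ x, x ≠ v → ¬ G.Adj v x → min 3 (G.neighborSet x).ncard ≤ (ψ '' G.neighborSet x).ncard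
  exists_adj : ∀ x y z, G.Adj v x → x ≠ c → G.Adj x y → G.Adj x z → y ≠ v → z ≠ v → y ≠ c →
    z ≠ c → y ≠ z → ∀ s, ∃ w, w ≠ v ∧ G.Adj x w ∧ ψ w ≠ s
  exists_adj_center : ∀ x y z, G.Adj v x → G.Adj v y → G.Adj v z → x ≠ c → y ≠ c → z ≠ c →
    x ≠ y → x ≠ z → y ≠ z → ∀ s t, ∃ w, w ≠ v ∧ w ≠ c ∧ (G.Adj c w ∨ G.Adj v w) ∧
      ψ w ≠ s ∧ ψ w ≠ t

theorem IsDynColoring.exists_adj_ne [Finite V] (hψ : IsDynColoring G 3 ψ) {x a b d : V}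
    (ha : G.Adj x a) (hb : G.Adj x b) (hd : G.Adj x d) (hab : a ≠ b) (had : a ≠ d) (hbd : b ≠ d)
    (s t : ℕ) : ∃ w, G.Adj x w ∧ ψ w ≠ s ∧ ψ w ≠ t := by
  by_contra! hc
  have h1 : (ψ '' G.neighborSet x) ⊆ {s, t} := by
    rintro _ ⟨w, hw, rfl⟩
    by_contra hst
    simp only [Set.mem_insert_iff, Set.mem_singleton_iff, not_or] at hst
    exact hst.2 (hc w hw hst.1)
  have h2 := (Set.ncard_le_ncard h1).trans (Set.ncard_insert_le s {t})
  rw [Set.ncard_singleton] at h2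
  have h3 : ({a, b, d} : Set V).ncard ≤ (G.neighborSet x).ncard := by
    refine Set.ncard_le_ncard ?_ (Set.toFinite _)
    rintro y (rfl | rfl | rfl) <;> assumption
  have h4 : ({a, b, d} : Set V).ncard = 3 := Set.ncard_eq_three.2 ⟨a, b, d, hab, had, hbd, rfl⟩
  have h5 := hψ.2 x
  omega

theorem IsDynColoring.exists_isReducedColoring [Finite V] (hvc : G.Adj v c)
    {φ : {x // x ≠ v} → ℕ} (hL : ∀ x, φ x ∈ L x.1) (hφ : IsDynColoring (G.mergeInto v c) 3 φ) :
    ∃ ψ, IsReducedColoring G v c L ψ := by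
  classical
  set ψ : V → ℕ := fun x => if h : x ≠ v then φ ⟨x, h⟩ else 0 with hψ
  have hval : ∀ x (hx : x ≠ v), ψ x = φ ⟨x, hx⟩ := fun x hx => dif_pos hx
  refine ⟨ψ, ?_, ?_, ?_, ?_, ?_, ?_⟩
  · intro x hx
    rw [hval x hx]
    exact hL _
  · intro x y hx hy hxy
    rw [hval x hx, hval y hy]
    exact hφ.1 ⟨fun h => hxy.ne (congrArg Subtype.val h), Or.inl hxy⟩
  · intro x hx hxc
    rw [hval x hx.ne', hval c hvc.ne']
    exact hφ.1 ⟨fun h => hxc (congrArg Subtype.val h), Or.inr (Or.inr ⟨rfl, hx⟩)⟩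
  · intro x hx hvx
    have h1 : G.neighborSet x = Subtype.val '' (G.mergeInto v c).neighborSet ⟨x, hx⟩ := by
      ext y
      constructor
      · intro hxy
        refine ⟨⟨y, ?_⟩, ⟨fun h => hxy.ne (congrArg Subtype.val h), Or.inl hxy⟩, rfl⟩
        rintro rfl
        exact hvx hxy.symm
      · rintro ⟨y, ⟨-, h | h | h⟩, rfl⟩
        · exact h
        · exact absurd (by rwa [show x = c from h.1]) hvx
        · exact absurd h.2 hvx
    have h2 : ψ '' G.neighborSet x = φ '' (G.mergeInto v c).neighborSet ⟨x, hx⟩ := by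
      rw [h1, Set.image_image]
      exact Set.image_congr fun y _ => hval y.1 y.2
    rw [h2, h1, Set.ncard_image_of_injective _ Subtype.val_injective]
    exact hφ.2 _
  · intro x y z hx hxc hxy hxz hy hz hyc hzc hyz s
    obtain ⟨w, ⟨-, hw⟩, h1, h2⟩ := hφ.exists_adj_ne (x := ⟨x, hx.ne'⟩) (a := ⟨y, hy⟩) (b := ⟨z, hz⟩)
      (d := ⟨c, hvc.ne'⟩) ⟨by simpa using hxy.ne, Or.inl hxy⟩ ⟨by simpa using hxz.ne, Or.inl hxz⟩
      ⟨by simpa using hxc, Or.inr (Or.inr ⟨rfl, hx⟩)⟩ (by simpa using hyz) (by simpa using hyc)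
      (by simpa using hzc) s (φ ⟨c, hvc.ne'⟩)
    refine ⟨w, w.2, ?_, by rwa [hval w w.2]⟩
    rcases hw with h | h | h
    · exact h
    · exact absurd h.1 hxc
    · exact absurd (congrArg φ (Subtype.ext h.1)) h2
  · intro x y z hx hy hz hxc hyc hzc hxy hxz hyz s t
    obtain ⟨w, ⟨hwc, hw⟩, h1, h2⟩ := hφ.exists_adj_ne (x := ⟨c, hvc.ne'⟩) (a := ⟨x, hx.ne'⟩)
      (b := ⟨y, hy.ne'⟩) (d := ⟨z, hz.ne'⟩)
      ⟨by simpa using hxc.symm, Or.inr (Or.inl ⟨rfl, hx⟩)⟩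
      ⟨by simpa using hyc.symm, Or.inr (Or.inl ⟨rfl, hy⟩)⟩
      ⟨by simpa using hzc.symm, Or.inr (Or.inl ⟨rfl, hz⟩)⟩ (by simpa using hxy)
      (by simpa using hxz) (by simpa using hyz) s t
    have hwc' : w.1 ≠ c := fun h => hwc (Subtype.ext h.symm)
    refine ⟨w, w.2, hwc', ?_, by rwa [hval w w.2], by rwa [hval w w.2]⟩
    rcases hw with h | h | h
    · exact Or.inl h
    · exact Or.inr h.2
    · exact absurd h.1 hwc'

theorem three_le_ncard_image [Finite V] {φ : V → ℕ} {S : Set V} {a b d : V} (ha : a ∈ S)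
    (hb : b ∈ S) (hd : d ∈ S) (hab : φ a ≠ φ b) (had : φ a ≠ φ d) (hbd : φ b ≠ φ d) :
    3 ≤ (φ '' S).ncard := by
  rw [← Set.ncard_eq_three.2 ⟨_, _, _, hab, had, hbd, rfl⟩]
  refine Set.ncard_le_ncard ?_ (Set.toFinite _)
  rintro y (rfl | rfl | rfl)
  exacts [⟨_, ha, rfl⟩, ⟨_, hb, rfl⟩, ⟨_, hd, rfl⟩]

/-- A reduced coloring extends to `v` if there is a small set of colors that contains the colors
of the neighbors of `v` and of two further differently colored neighbors of each of them. -/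
theorem IsReducedColoring.exists_extension [Finite V] (hψ : IsReducedColoring G v c L ψ)
    (hL : 6 ≤ (L v).card) (F : Finset ℕ) (hF : F.card ≤ 5) {a b d : V} (ha : G.Adj v a)
    (hb : G.Adj v b) (hd : G.Adj v d) (hab : ψ a ≠ ψ b) (had : ψ a ≠ ψ d) (hbd : ψ b ≠ ψ d)
    (hvF : ∀ x, G.Adj v x → ψ x ∈ F)
    (hpq : ∀ x, G.Adj v x → ∃ p q, G.Adj x p ∧ G.Adj x q ∧ p ≠ v ∧ q ≠ v ∧ ψ p ≠ ψ q ∧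
      ψ p ∈ F ∧ ψ q ∈ F) :
    ∃ φ : V → ℕ, (∀ x, φ x ∈ L x) ∧ IsDynColoring G 3 φ := by
  classical
  obtain ⟨t, htL, htF⟩ : ∃ t ∈ L v, t ∉ F := by
    by_contra! h
    have := Finset.card_le_card h
    omega
  have ht : ∀ {y}, ψ y ∈ F → t ≠ ψ y := fun hy h => htF (h ▸ hy)
  have h1 : Function.update ψ v t v = t := Function.update_self ..
  have h2 : ∀ x, x ≠ v → Function.update ψ v t x = ψ x := fun x hx => Function.update_of_ne hx _ _
  refine ⟨Function.update ψ v t, fun x => ?_, fun x y hxy => ?_, fun x => ?_⟩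
  · by_cases hx : x = v
    · rw [hx, h1]; exact htL
    · rw [h2 x hx]; exact hψ.mem x hx
  · by_cases hx : x = v
    · subst hx
      rw [h1, h2 y hxy.ne']
      exact ht (hvF y hxy)
    · rw [h2 x hx]
      by_cases hy : y = v
      · subst hy
        rw [h1]
        exact (ht (hvF x hxy.symm)).symm
      · rw [h2 y hy]
        exact hψ.ne x y hx hy hxy
  · by_cases hx : x = v
    · subst hx
      refine min_le_of_left_le (three_le_ncard_image (S := G.neighborSet x) ha hb hd ?_ ?_ ?_)
      all_goals rwa [h2 _ (SimpleGraph.Adj.ne' ‹_›), h2 _ (SimpleGraph.Adj.ne' ‹_›)]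
    · by_cases hvx : G.Adj v x
      · obtain ⟨p, q, hp, hq, hpv, hqv, hpq, hpF, hqF⟩ := hpq x hvx
        refine min_le_of_left_le (three_le_ncard_image (S := G.neighborSet x) hvx.symm hp hq ?_ ?_ ?_)
        · rw [h1, h2 p hpv]; exact ht hpF
        · rw [h1, h2 q hqv]; exact ht hqF
        · rw [h2 p hpv, h2 q hqv]; exact hpq
      · have h3 : Function.update ψ v t '' G.neighborSet x = ψ '' G.neighborSet x := by
          refine Set.image_congr fun y hy => h2 y ?_
          rintro rfl
          exact hvx hy.symm
        rw [h3]
        exact hψ.dyn x hx hvx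

variable {a b d e : V}

/-- Extension to a vertex with exactly three neighbors. -/
theorem IsReducedColoring.exists_extension_three [Finite V] (hψ : IsReducedColoring G v c L ψ)
    (hL : 6 ≤ (L v).card) (hN : ∀ x, G.Adj v x ↔ x = c ∨ x = a ∨ x = b)
    (hca : G.Adj c a) (hab : G.Adj a b) (hbc : G.Adj b c) :
    ∃ φ : V → ℕ, (∀ x, φ x ∈ L x) ∧ IsDynColoring G 3 φ := by
  have hc : G.Adj v c := (hN c).2 (by simp)
  have ha : G.Adj v a := (hN a).2 (by simp)
  have hb : G.Adj v b := (hN b).2 (by simp)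
  have h1 := hψ.ne _ _ hc.ne' ha.ne' hca
  have h2 := hψ.ne _ _ ha.ne' hb.ne' hab
  have h3 := hψ.ne _ _ hb.ne' hc.ne' hbc
  refine hψ.exists_extension hL {ψ c, ψ a, ψ b} (Finset.card_le_three.trans (by simp)) hc ha hb h1
    h3.symm h2 (fun x hx => ?_) (fun x hx => ?_)
  · rcases (hN x).1 hx with rfl | rfl | rfl <;> simp
  · rcases (hN x).1 hx with rfl | rfl | rfl
    · exact ⟨a, b, hca, hbc.symm, ha.ne', hb.ne', h2, by simp, by simp⟩
    · exact ⟨c, b, hca.symm, hab, hc.ne', hb.ne', h3.symm, by simp, by simp⟩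
    · exact ⟨c, a, hbc, hab.symm, hc.ne', ha.ne', h1, by simp, by simp⟩

/-- Extension to a vertex with exactly four neighbors. -/
theorem IsReducedColoring.exists_extension_four [Finite V] (hψ : IsReducedColoring G v c L ψ)
    (hL : 6 ≤ (L v).card) (hN : ∀ x, G.Adj v x ↔ x = c ∨ x = a ∨ x = b ∨ x = d)
    (hca : G.Adj c a) (hab : G.Adj a b) (hbd : G.Adj b d) (hdc : G.Adj d c) (hcb : c ≠ b)
    (had : a ≠ d) :
    ∃ φ : V → ℕ, (∀ x, φ x ∈ L x) ∧ IsDynColoring G 3 φ := by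
  have hc : G.Adj v c := (hN c).2 (by simp)
  have ha : G.Adj v a := (hN a).2 (by simp)
  have hb : G.Adj v b := (hN b).2 (by simp)
  have hd : G.Adj v d := (hN d).2 (by simp)
  have h1 := hψ.ne _ _ hc.ne' ha.ne' hca
  have h2 := hψ.ne _ _ ha.ne' hb.ne' hab
  have h3 := hψ.ne _ _ hb.ne' hd.ne' hbd
  have h4 := hψ.ne _ _ hd.ne' hc.ne' hdc
  have h5 := hψ.ne_center b hb hcb.symm
  obtain ⟨F, hF, hcF, haF, hbF, hdF, ⟨p, q, hp⟩, ⟨p', q', hp'⟩⟩ : ∃ F : Finset ℕ, F.card ≤ 5 ∧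
      ψ c ∈ F ∧ ψ a ∈ F ∧ ψ b ∈ F ∧ ψ d ∈ F ∧
      (∃ p q, G.Adj c p ∧ G.Adj c q ∧ p ≠ v ∧ q ≠ v ∧ ψ p ≠ ψ q ∧ ψ p ∈ F ∧ ψ q ∈ F) ∧
      (∃ p q, G.Adj b p ∧ G.Adj b q ∧ p ≠ v ∧ q ≠ v ∧ ψ p ≠ ψ q ∧ ψ p ∈ F ∧ ψ q ∈ F) := by
    by_cases hs : ψ a = ψ d
    · obtain ⟨x, hxv, hbx, hx⟩ := hψ.exists_adj b a d hb hcb.symm hab.symm hbd ha.ne' hd.ne'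
        hca.ne' hdc.ne had (ψ a)
      obtain ⟨y, hyv, hyc, hy, hya, hyb⟩ := hψ.exists_adj_center a b d ha hb hd hca.ne' hcb.symm
        hdc.ne hab.ne had hbd.ne (ψ a) (ψ b)
      have hcy : G.Adj c y := by
        refine hy.resolve_right fun hvy => ?_
        rcases (hN y).1 hvy with rfl | rfl | rfl | rfl
        · exact hyc rfl
        · exact hya rfl
        · exact hyb rfl
        · exact hya hs.symm
      refine ⟨{ψ c, ψ a, ψ b, ψ x, ψ y}, Finset.card_le_five, by simp, by simp, by simp,
        by simp [← hs], ⟨a, y, hca, hcy, ha.ne', hyv, hya.symm, by simp, by simp⟩,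
        ⟨a, x, hab.symm, hbx, ha.ne', hxv, hx.symm, by simp, by simp⟩⟩
    · exact ⟨{ψ c, ψ a, ψ b, ψ d}, Finset.card_le_four.trans (by simp), by simp, by simp, by simp,
        by simp, ⟨a, d, hca, hdc.symm, ha.ne', hd.ne', hs, by simp, by simp⟩,
        ⟨a, d, hab.symm, hbd, ha.ne', hd.ne', hs, by simp, by simp⟩⟩
  refine hψ.exists_extension hL F hF hc ha hb h1 h5.symm h2 (fun x hx => ?_) (fun x hx => ?_)
  · rcases (hN x).1 hx with rfl | rfl | rfl | rfl <;> assumption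
  · rcases (hN x).1 hx with rfl | rfl | rfl | rfl
    · exact ⟨p, q, hp⟩
    · exact ⟨c, b, hca.symm, hab, hc.ne', hb.ne', h5.symm, hcF, hbF⟩
    · exact ⟨p', q', hp'⟩
    · exact ⟨c, b, hdc, hbd.symm, hc.ne', hb.ne', h5.symm, hcF, hbF⟩

/-- Extension to a vertex with exactly five neighbors. -/
theorem IsReducedColoring.exists_extension_five [Finite V] (hψ : IsReducedColoring G v c L ψ)
    (hL : 6 ≤ (L v).card) (hN : ∀ x, G.Adj v x ↔ x = c ∨ x = a ∨ x = b ∨ x = d ∨ x = e)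
    (hca : G.Adj c a) (hab : G.Adj a b) (hbd : G.Adj b d) (hde : G.Adj d e) (hec : G.Adj e c)
    (hcb : c ≠ b) (hcd : c ≠ d) (had : a ≠ d) (hbe : b ≠ e)
    (hae : G.Adj a e ∨ ∃ w, w ≠ v ∧ G.Adj c w ∧ (G.Adj w a ∨ G.Adj w e)) :
    ∃ φ : V → ℕ, (∀ x, φ x ∈ L x) ∧ IsDynColoring G 3 φ := by
  have hc : G.Adj v c := (hN c).2 (by simp)
  have ha : G.Adj v a := (hN a).2 (by simp)
  have hb : G.Adj v b := (hN b).2 (by simp)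
  have hd : G.Adj v d := (hN d).2 (by simp)
  have he : G.Adj v e := (hN e).2 (by simp)
  have h1 := hψ.ne _ _ hc.ne' ha.ne' hca
  have h2 := hψ.ne _ _ ha.ne' hb.ne' hab
  have h3 := hψ.ne _ _ hb.ne' hd.ne' hbd
  have h4 := hψ.ne _ _ hd.ne' he.ne' hde
  have h5 := hψ.ne_center b hb hcb.symm
  have h6 := hψ.ne_center d hd hcd.symm
  obtain ⟨F, hF, hcF, haF, hbF, hdF, heF, ⟨p, q, hp⟩, ⟨p', q', hp'⟩, ⟨p'', q'', hp''⟩⟩ :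
      ∃ F : Finset ℕ, F.card ≤ 5 ∧ ψ c ∈ F ∧ ψ a ∈ F ∧ ψ b ∈ F ∧ ψ d ∈ F ∧ ψ e ∈ F ∧
      (∃ p q, G.Adj c p ∧ G.Adj c q ∧ p ≠ v ∧ q ≠ v ∧ ψ p ≠ ψ q ∧ ψ p ∈ F ∧ ψ q ∈ F) ∧
      (∃ p q, G.Adj b p ∧ G.Adj b q ∧ p ≠ v ∧ q ≠ v ∧ ψ p ≠ ψ q ∧ ψ p ∈ F ∧ ψ q ∈ F) ∧
      (∃ p q, G.Adj d p ∧ G.Adj d q ∧ p ≠ v ∧ q ≠ v ∧ ψ p ≠ ψ q ∧ ψ p ∈ F ∧ ψ q ∈ F) := by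
    by_cases hs : ψ a = ψ e
    · obtain ⟨w, hwv, hcw, hw⟩ :=
        hae.resolve_left fun hae => hψ.ne _ _ ha.ne' he.ne' hae hs
      have hwa : ψ a ≠ ψ w := by
        rcases hw with hw | hw
        · exact (hψ.ne _ _ hwv ha.ne' hw).symm
        · rw [hs]
          exact (hψ.ne _ _ hwv he.ne' hw).symm
      exact ⟨{ψ c, ψ a, ψ b, ψ d, ψ w}, Finset.card_le_five, by simp, by simp, by simp, by simp,
        by simp [← hs], ⟨a, w, hca, hcw, ha.ne', hwv, hwa, by simp, by simp⟩,
        ⟨a, d, hab.symm, hbd, ha.ne', hd.ne', by rw [hs]; exact h4.symm, by simp, by simp⟩,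
        ⟨b, e, hbd.symm, hde, hb.ne', he.ne', by rw [← hs]; exact h2.symm, by simp,
          by simp [← hs]⟩⟩
    · obtain ⟨x, hxv, hbx, hxa, hdx⟩ : ∃ x, x ≠ v ∧ G.Adj b x ∧ ψ x ≠ ψ a ∧
          (ψ d = ψ x ∨ ψ d = ψ a) := by
        by_cases hda : ψ d = ψ a
        · obtain ⟨x, h⟩ := hψ.exists_adj b a d hb hcb.symm hab.symm hbd ha.ne' hd.ne' hca.ne'
            hcd.symm had (ψ a)
          exact ⟨x, h.1, h.2.1, h.2.2, Or.inr hda⟩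
        · exact ⟨d, hd.ne', hbd, hda, Or.inl rfl⟩
      obtain ⟨y, hyv, hdy, hyb, hey⟩ : ∃ y, y ≠ v ∧ G.Adj d y ∧ ψ y ≠ ψ b ∧
          (ψ e = ψ y ∨ ψ e = ψ b) := by
        by_cases heb : ψ e = ψ b
        · obtain ⟨y, h⟩ := hψ.exists_adj d b e hd hcd.symm hbd.symm hde hb.ne' he.ne' hcb.symm
            hec.ne hbe (ψ b)
          exact ⟨y, h.1, h.2.1, h.2.2, Or.inr heb⟩
        · exact ⟨e, he.ne', hde, heb, Or.inl rfl⟩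
      have heF : ψ e ∈ ({ψ c, ψ a, ψ b, ψ x, ψ y} : Finset ℕ) := by
        rcases hey with h | h <;> simp [h]
      exact ⟨{ψ c, ψ a, ψ b, ψ x, ψ y}, Finset.card_le_five, by simp, by simp, by simp,
        by rcases hdx with h | h <;> simp [h], heF,
        ⟨a, e, hca, hec.symm, ha.ne', he.ne', hs, by simp, heF⟩,
        ⟨a, x, hab.symm, hbx, ha.ne', hxv, hxa.symm, by simp, by simp⟩,
        ⟨b, y, hbd.symm, hdy, hb.ne', hyv, hyb.symm, by simp, by simp⟩⟩
  refine hψ.exists_extension hL F hF hc ha hb h1 h5.symm h2 (fun x hx => ?_) (fun x hx => ?_)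
  · rcases (hN x).1 hx with rfl | rfl | rfl | rfl | rfl <;> assumption
  · rcases (hN x).1 hx with rfl | rfl | rfl | rfl | rfl
    · exact ⟨p, q, hp⟩
    · exact ⟨c, b, hca.symm, hab, hc.ne', hb.ne', h5.symm, hcF, hbF⟩
    · exact ⟨p', q', hp'⟩
    · exact ⟨p'', q'', hp''⟩
    · exact ⟨c, d, hec, hde.symm, hc.ne', hd.ne', h6.symm, hcF, hdF⟩

end Coloring

namespace RotationSystem

variable {V : Type} [Fintype V] [DecidableEq V] (P : RotationSystem V)

/-- A set of darts that is closed under the rotation contains all darts at a vertex once it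
contains one of them. -/
theorem mem_of_rot_closed {S : Set P.graph.Dart} (hS : ∀ d ∈ S, P.rot d ∈ S) {d : P.graph.Dart}
    (hd : d ∈ S) {e : P.graph.Dart} (hde : d.fst = e.fst) : e ∈ S := by
  obtain ⟨n, rfl⟩ := P.rot_orbit d e hde
  clear hde
  induction n with
  | zero => exact hd
  | succ n ih => rw [pow_succ', Equiv.Perm.mul_apply]; exact hS _ ih

theorem adj_snd_of_faceSize_rot {d : P.graph.Dart} (h : P.faceSize (P.rot d) = 3) :
    P.graph.Adj (P.rot d).snd d.snd := by
  have h1 : P.facePerm (P.facePerm (P.rot d)) = d.symm := by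
    refine P.facePerm.injective ?_
    rw [P.facePerm_pow_three h, P.facePerm_symm_apply]
  have h2 := (P.facePerm (P.rot d)).adj
  rw [P.facePerm_fst, ← P.facePerm_fst (P.facePerm (P.rot d)), h1] at h2
  exact h2

variable {P} in
theorem IsInner.rot_facePerm_rot_symm {v : V} (hv : P.IsInner v) {d : P.graph.Dart}
    (hd : d.fst = v) : P.rot (P.facePerm (P.rot d)).symm = d.symm := by
  rw [← P.facePerm_symm_apply, Dart.symm_symm, hv.facePerm_facePerm_rot hd]

theorem nbr_eq_nbr {d : P.graph.Dart} {k : ℕ} (hk : (P.graph.neighborSet d.fst).ncard = k)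
    (i j : ℕ) (h : i % k = j % k) : P.nbr d i = P.nbr d j :=
  (P.nbr_eq_nbr_iff d i j).2 (by rw [hk]; exact h)

theorem nbr_ne_nbr {d : P.graph.Dart} {k : ℕ} (hk : (P.graph.neighborSet d.fst).ncard = k)
    (i j : ℕ) (h : i % k ≠ j % k) : P.nbr d i ≠ P.nbr d j :=
  fun he => h (by have := (P.nbr_eq_nbr_iff d i j).1 he; rwa [hk] at this)

theorem adj_iff_exists_nbr {d : P.graph.Dart} {k : ℕ}
    (hk : (P.graph.neighborSet d.fst).ncard = k) (x : V) :
    P.graph.Adj d.fst x ↔ ∃ i < k, x = P.nbr d i := by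
  constructor
  · intro h
    obtain ⟨i, hi, rfl⟩ := P.exists_nbr_eq d h
    exact ⟨i, hk ▸ hi, rfl⟩
  · rintro ⟨i, -, rfl⟩
    exact P.adj_nbr d i

variable {P} in
/-- A connected graph with an inner vertex of degree two is a triangle. -/
theorem IsInner.card_le_of_ncard_eq_two {d : P.graph.Dart} (hv : P.IsInner d.fst)
    (hk : (P.graph.neighborSet d.fst).ncard = 2) : Fintype.card V ≤ 3 := by
  have hrot : P.rot (P.rot d) = d := by
    refine Dart.ext _ _ (Prod.ext ?_ ?_)
    · rw [P.rot_fst, P.rot_fst]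
    · exact P.nbr_eq_nbr hk 2 0 rfl
  have key : ∀ e : P.graph.Dart, e.fst = d.fst → P.rot (P.rot e) = e →
      ∀ x, P.graph.Adj e.snd x → x = d.fst ∨ x = (P.rot e).snd := by
    intro e he hee x hx
    have h1 : (P.facePerm e).snd = (P.rot e).snd := by
      have := hv.facePerm_rot (d := P.rot e) ((P.rot_fst e).trans he)
      rw [hee] at this
      exact (Prod.ext_iff.1 this).2
    have h2 : (P.facePerm (P.rot e)).symm = P.facePerm e := by
      refine Dart.ext _ _ (Prod.ext ?_ ?_)
      · exact (Prod.ext_iff.1 (hv.facePerm_rot he)).2.trans (P.facePerm_fst e).symm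
      · exact (P.facePerm_fst _).trans h1.symm
    have h3 := P.mem_of_rot_closed (S := {e.symm, P.facePerm e}) (d := e.symm)
      (e := ⟨(e.snd, x), hx⟩) (by
        rintro f (rfl | rfl)
        · exact Or.inr rfl
        · rw [← h2, hv.rot_facePerm_rot_symm he]
          exact Or.inl rfl) (Or.inl rfl) rfl
    rcases h3 with h3 | h3
    · exact Or.inl ((congrArg (fun d : P.graph.Dart => d.snd) h3).trans he)
    · exact Or.inr ((congrArg (fun d : P.graph.Dart => d.snd) h3).trans h1)
  have hall : ∀ y, y ∈ ({d.fst, d.snd, (P.rot d).snd} : Finset V) := by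
    intro y
    have := P.eq_univ_of_adj_closed {d.fst, d.snd, (P.rot d).snd} (x := d.fst) (Or.inl rfl)
      (by
        rintro y (rfl | rfl | rfl) z hz
        · obtain ⟨i, hi, rfl⟩ := (P.adj_iff_exists_nbr hk z).1 hz
          interval_cases i
          · exact Or.inr (Or.inl rfl)
          · exact Or.inr (Or.inr rfl)
        · rcases key d rfl hrot z hz with rfl | rfl
          · exact Or.inl rfl
          · exact Or.inr (Or.inr rfl)
        · rcases key (P.rot d) (P.rot_fst d) (by rw [hrot]) z hz with rfl | rfl
          · exact Or.inl rfl
          · rw [hrot]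
            exact Or.inr (Or.inl rfl)) y
    simpa using this
  rw [← Finset.card_univ]
  exact (Finset.card_le_card fun y _ => hall y).trans Finset.card_le_three

end RotationSystem

namespace NearTriangulation

open RotationSystem

variable {V : Type} [Fintype V] [DecidableEq V] (P : NearTriangulation V)

/-- If the boundary walk of the outer face visits no vertex twice, then a neighbor `c` of an inner
vertex `v` that has a neighbor other than `v` and the two common neighbors of `v` and `c` also has
a neighbor other than `v` that is adjacent to one of these two. -/
theorem exists_adj_of_contractible {d₀ : P.graph.Dart} (h : P.toRotationSystem.Contractible d₀)
    (hcyc : Set.InjOn (fun d : P.graph.Dart => d.fst)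
      {d : P.graph.Dart | P.toRotationSystem.SameFace P.outer d})
    {x : V} (hx : P.graph.Adj d₀.snd x) (hxv : x ≠ d₀.fst) (hx1 : x ≠ P.nbr d₀ 1)
    (hxm : x ≠ P.prevNbr d₀) :
    ∃ w, w ≠ d₀.fst ∧ P.graph.Adj d₀.snd w ∧
      (P.graph.Adj w (P.nbr d₀ 1) ∨ P.graph.Adj w (P.prevNbr d₀)) := by
  set e₁ := P.facePerm d₀ with he₁
  set f₁ := (P.facePerm (P.rot d₀)).symm with hf₁
  have he₁c : e₁.fst = d₀.snd := P.facePerm_fst d₀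
  have he₁m : e₁.snd = P.prevNbr d₀ := (Prod.ext_iff.1 h.facePerm_toProd).2
  have hf₁c : f₁.fst = d₀.snd := (Prod.ext_iff.1 h.facePerm_rot_toProd).2
  have hf₁a : f₁.snd = P.nbr d₀ 1 := (Prod.ext_iff.1 h.facePerm_rot_toProd).1
  have hrf₁ : P.rot f₁ = d₀.symm := h.inner.rot_facePerm_rot_symm rfl
  have hrd : P.rot d₀.symm = e₁ := rfl
  have hxd : (⟨(d₀.snd, x), hx⟩ : P.graph.Dart) ∉ ({d₀.symm, e₁, f₁} : Set P.graph.Dart) := by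
    rintro (h1 | h1 | h1)
    · exact hxv (congrArg (fun d : P.graph.Dart => d.snd) h1)
    · exact hxm ((congrArg (fun d : P.graph.Dart => d.snd) h1).trans he₁m)
    · exact hx1 ((congrArg (fun d : P.graph.Dart => d.snd) h1).trans hf₁a)
  have hne : P.rot e₁ ≠ d₀.symm ∧ P.rot e₁ ≠ f₁ := by
    by_contra hc
    refine hxd (P.mem_of_rot_closed (d := d₀.symm) ?_ (Or.inl rfl) rfl)
    rintro d (rfl | rfl | rfl)
    · exact Or.inr (Or.inl hrd)
    · simp only [Set.mem_insert_iff, Set.mem_singleton_iff]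
      tauto
    · exact Or.inl hrf₁
  have hsnd : ∀ d : P.graph.Dart, d.fst = d₀.snd → d ≠ d₀.symm → d.snd ≠ d₀.fst :=
    fun d h1 h2 h3 => h2 (Dart.ext _ _ (Prod.ext h1 h3))
  by_cases ho : P.SameFace P.outer (P.rot e₁)
  · have hf : ¬ P.SameFace P.outer f₁ := fun hf => hne.2
      (hcyc ho hf (((P.rot_fst e₁).trans he₁c).trans hf₁c.symm))
    set f₂ := P.rot.symm f₁ with hf₂
    have hrf₂ : P.rot f₂ = f₁ := P.rot.apply_symm_apply _
    have hf₂c : f₂.fst = d₀.snd := by rw [← P.rot_fst, hrf₂, hf₁c]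
    have hadj := P.adj_snd_of_faceSize_rot (d := f₂) (by rw [hrf₂]; exact P.bounded_tri _ hf)
    rw [hrf₂, hf₁a] at hadj
    refine ⟨f₂.snd, hsnd _ hf₂c fun h1 => ?_, hf₂c ▸ f₂.adj, Or.inl hadj.symm⟩
    have h2 : e₁ = f₁ := by rw [← hrd, ← h1, hrf₂]
    exact h.nbr_one_ne_prevNbr (by rw [← hf₁a, ← he₁m, h2])
  · have hadj := P.adj_snd_of_faceSize_rot (P.bounded_tri _ ho)
    have hc := (P.rot_fst e₁).trans he₁c
    exact ⟨(P.rot e₁).snd, hsnd _ hc hne.1, hc ▸ (P.rot e₁).adj, Or.inr (he₁m ▸ hadj)⟩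

theorem contractible_of_ncard_eq_three {d : P.graph.Dart} (hv : ¬ P.OnOuter d.fst)
    (hk : (P.graph.neighborSet d.fst).ncard = 3) : P.toRotationSystem.Contractible d :=
  ⟨P.isInner hv, hk.ge, fun i _ _ => by omega⟩

/-- An inner vertex of degree four lies on a contractible edge. -/
theorem exists_contractible_of_ncard_eq_four {d : P.graph.Dart} (hv : ¬ P.OnOuter d.fst)
    (hk : (P.graph.neighborSet d.fst).ncard = 4) :
    ∃ d₀ : P.graph.Dart, d₀.fst = d.fst ∧ P.toRotationSystem.Contractible d₀ := by
  have key : ∀ e : P.graph.Dart, e.fst = d.fst → ¬ P.graph.Adj e.snd (P.nbr e 2) →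
      P.toRotationSystem.Contractible e := by
    intro e he hadj
    rw [← he] at hv hk
    refine ⟨P.isInner hv, by omega, fun i h1 h2 => ?_⟩
    obtain rfl : i = 2 := by omega
    exact hadj
  by_cases hadj : P.graph.Adj d.snd (P.nbr d 2)
  · refine ⟨P.rot d, P.rot_fst d, key _ (P.rot_fst d) ?_⟩
    exact IsPlane.not_adj_of_adj P.toRotationSystem P.plane d (k := 3) le_rfl (by omega) hadj
  · exact ⟨d, rfl, key d rfl hadj⟩

/-- An inner vertex of degree five in a graph with more than six vertices lies on a contractible
edge whose other end has a neighbor outside of the wheel unless the two common neighbors of its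
ends are adjacent. -/
theorem exists_contractible_of_ncard_eq_five {d : P.graph.Dart} (hv : ¬ P.OnOuter d.fst)
    (hk : (P.graph.neighborSet d.fst).ncard = 5) (hcard : 6 < Fintype.card V) :
    ∃ d₀ : P.graph.Dart, d₀.fst = d.fst ∧ P.toRotationSystem.Contractible d₀ ∧
      (P.graph.Adj (P.nbr d₀ 1) (P.nbr d₀ 4) ∨
        ∃ x, P.graph.Adj d₀.snd x ∧ x ≠ d₀.fst ∧ x ≠ P.nbr d₀ 1 ∧ x ≠ P.nbr d₀ 4) := by
  have key : ∀ e : P.graph.Dart, e.fst = d.fst → ¬ P.graph.Adj e.snd (P.nbr e 2) →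
      ¬ P.graph.Adj e.snd (P.nbr e 3) → P.toRotationSystem.Contractible e := by
    intro e he h2 h3
    rw [← he] at hv hk
    refine ⟨P.isInner hv, by omega, fun i hi hi' => ?_⟩
    obtain rfl | rfl : i = 2 ∨ i = 3 := by omega
    · exact h2
    · exact h3
  have hpow : ∀ (e : P.graph.Dart) (j : ℕ), e.fst = d.fst → ((P.rot ^ j) e).fst = d.fst :=
    fun e j he => (P.rot_pow_fst e j).trans he
  have hdeg : ∀ e : P.graph.Dart, e.fst = d.fst → (P.graph.neighborSet e.fst).ncard = 5 :=
    fun e he => by rw [he, hk]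
  by_cases hadj : ∃ e : P.graph.Dart, e.fst = d.fst ∧ P.graph.Adj (P.nbr e 1) (P.nbr e 4)
  · obtain ⟨e, he, hadj⟩ := hadj
    have h0 : P.graph.Adj (P.nbr ((P.rot ^ 4) e) 0) (P.nbr ((P.rot ^ 4) e) 2) := by
      rw [P.nbr_rot_pow, P.nbr_rot_pow, P.nbr_eq_nbr (hdeg e he) (2 + 4) 1 rfl]
      exact hadj.symm
    have hchord : ∀ j, 2 ≤ j → j < 4 → ¬ P.graph.Adj e.snd (P.nbr e j) := by
      intro j hj hj'
      have h1 := IsPlane.not_adj_of_adj P.toRotationSystem P.plane _ (k := j + 1) (by omega)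
        (by rw [hdeg _ (hpow e 4 he)]; omega) h0
      rw [P.nbr_rot_pow, P.nbr_rot_pow, P.nbr_eq_nbr (hdeg e he) (1 + 4) 0 rfl,
        P.nbr_eq_nbr (hdeg e he) (j + 1 + 4) j (by omega)] at h1
      exact h1
    exact ⟨e, he, key e he (hchord 2 le_rfl (by omega)) (hchord 3 (by omega) (by omega)),
      Or.inl hadj⟩
  push Not at hadj
  have hcontr : ∀ e : P.graph.Dart, e.fst = d.fst → P.toRotationSystem.Contractible e := by
    intro e he
    have h1 := hadj _ (hpow e 1 he)
    have h4 := hadj _ (hpow e 4 he)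
    rw [P.nbr_rot_pow, P.nbr_rot_pow, P.nbr_eq_nbr (hdeg e he) (4 + 1) 0 rfl] at h1
    rw [P.nbr_rot_pow, P.nbr_rot_pow, P.nbr_eq_nbr (hdeg e he) (1 + 4) 0 rfl,
      P.nbr_eq_nbr (hdeg e he) (4 + 4) 3 rfl] at h4
    exact key e he (fun h => h1 h.symm) h4
  by_contra! hc
  have hclosed : ∀ i x, P.graph.Adj (P.nbr d i) x → x = d.fst ∨ P.graph.Adj d.fst x := by
    intro i x hx
    have h1 := (hc ((P.rot ^ i) d) (hpow d i rfl) (hcontr _ (hpow d i rfl))).2 x hx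
    rw [hpow d i rfl, P.nbr_rot_pow, P.nbr_rot_pow] at h1
    by_cases h2 : x = d.fst
    · exact Or.inl h2
    by_cases h3 : x = P.nbr d (1 + i)
    · exact Or.inr (h3 ▸ P.adj_nbr d _)
    · rw [h1 h2 h3]
      exact Or.inr (P.adj_nbr d _)
  have huniv : ∀ y, y ∈ insert d.fst (P.graph.neighborSet d.fst) := fun y => by
    refine P.eq_univ_of_adj_closed (insert d.fst (P.graph.neighborSet d.fst)) (x := d.fst)
      (Or.inl rfl) ?_ y
    rintro y (rfl | hy) z hz
    · exact Or.inr hz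
    · obtain ⟨i, -, rfl⟩ := (P.adj_iff_exists_nbr hk y).1 hy
      exact hclosed i z hz
  have h1 : (Set.univ : Set V).ncard ≤ _ :=
    (Set.ncard_le_ncard fun y _ => huniv y).trans (Set.ncard_insert_le _ _)
  rw [hk, Set.ncard_univ, Nat.card_eq_fintype_card] at h1
  omega

end NearTriangulation

/-- **Claim 2.2.** Let `G` be a near-triangulation whose outer face is bounded by a cycle,
which is not 3-dynamically colorable from some list assignment with all lists of size at
least `6`, and which is vertex-minimal with this property (every near-triangulation with
fewer vertices is 3-dynamically 6-choosable). Then every vertex of `G` not on the boundary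
cycle of the outer face has degree at least `6` in `G`. -/
theorem minimal_counterexample_inner_degree_ge_six {V : Type} [Fintype V] [DecidableEq V]
    (P : NearTriangulation V)
    (hcyc : Set.InjOn (fun d : P.graph.Dart => d.fst)
      {d : P.graph.Dart | P.toRotationSystem.SameFace P.outer d})
    (L : V → Finset ℕ) (hL : ∀ v : V, 6 ≤ (L v).card)
    (hbad : ¬ ∃ φ : V → ℕ, (∀ v : V, φ v ∈ L v) ∧ IsDynColoring P.graph 3 φ)
    (hmin : ∀ (W : Type) [Fintype W] [DecidableEq W] (Q : NearTriangulation W),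
      Fintype.card W < Fintype.card V →
      ∀ L' : W → Finset ℕ, (∀ w : W, 6 ≤ (L' w).card) →
        ∃ φ : W → ℕ, (∀ w : W, φ w ∈ L' w) ∧ IsDynColoring Q.graph 3 φ) :
    ∀ v : V, ¬ P.OnOuter v → 6 ≤ (P.graph.neighborSet v).ncard := by
  intro v hv
  by_contra! hlt
  have hcard : 6 < Fintype.card V := by
    by_contra! hcard
    exact hbad (exists_isDynColoring_of_card_le hcard hL 3)
  have hpos : (P.graph.neighborSet v).ncard ≠ 0 := by
    intro h0
    have h1 : (Set.univ : Set V).ncard ≤ ({v} : Set V).ncard := by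
      refine Set.ncard_le_ncard fun y _ => P.eq_univ_of_adj_closed {v} rfl ?_ y
      rintro _ rfl z hz
      have h2 := (Set.ncard_eq_zero (Set.toFinite _)).1 h0
      exact absurd hz (Set.eq_empty_iff_forall_notMem.1 h2 z)
    rw [Set.ncard_univ, Nat.card_eq_fintype_card, Set.ncard_singleton] at h1
    omega
  obtain ⟨x, hx⟩ := Set.nonempty_of_ncard_ne_zero hpos
  obtain ⟨d, rfl⟩ : ∃ d : P.graph.Dart, d.fst = v := ⟨⟨(v, x), hx⟩, rfl⟩
  have hcolor : ∀ d₀ : P.graph.Dart, d₀.fst = d.fst → P.toRotationSystem.Contractible d₀ →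
      ∃ ψ, IsReducedColoring P.graph d₀.fst d₀.snd L ψ := by
    intro d₀ hd₀ h
    obtain ⟨Q, hQ⟩ := P.exists_contract (d₀ := d₀) (by rwa [hd₀]) h
    obtain ⟨φ, hφL, hφ⟩ := hmin _ Q (Fintype.card_subtype_lt (x := d₀.fst) (by simp))
      (fun w => L w) (fun w => hL w)
    rw [hQ] at hφ
    exact hφ.exists_isReducedColoring d₀.adj hφL
  have hinner := P.isInner hv
  have hadj : ∀ d₀ : P.graph.Dart, d₀.fst = d.fst → ∀ i,
      P.graph.Adj (P.nbr d₀ i) (P.nbr d₀ (i + 1)) := fun d₀ hd₀ i => hinner.adj_nbr_succ hd₀ i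
  obtain hk | hk | hk | hk | hk : (P.graph.neighborSet d.fst).ncard = 1 ∨
      (P.graph.neighborSet d.fst).ncard = 2 ∨ (P.graph.neighborSet d.fst).ncard = 3 ∨
      (P.graph.neighborSet d.fst).ncard = 4 ∨ (P.graph.neighborSet d.fst).ncard = 5 := by omega
  · exact (hadj d rfl 0).ne (P.nbr_eq_nbr hk 0 1 rfl)
  · have := hinner.card_le_of_ncard_eq_two hk
    omega
  · obtain ⟨ψ, hψ⟩ := hcolor d rfl (P.contractible_of_ncard_eq_three hv hk)
    refine hbad (hψ.exists_extension_three (a := P.nbr d 1) (b := P.nbr d 2) (hL _) (fun x => ?_)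
      (hadj d rfl 0) (hadj d rfl 1) ?_)
    · rw [P.adj_iff_exists_nbr hk]
      constructor
      · rintro ⟨i, hi, rfl⟩
        interval_cases i <;> simp [RotationSystem.nbr_zero]
      · rintro (rfl | rfl | rfl)
        exacts [⟨0, by omega, rfl⟩, ⟨1, by omega, rfl⟩, ⟨2, by omega, rfl⟩]
    · have := hadj d rfl 2
      rwa [P.nbr_eq_nbr hk (2 + 1) 0 rfl] at this
  · obtain ⟨d₀, hd₀, h⟩ := P.exists_contractible_of_ncard_eq_four hv hk
    obtain ⟨ψ, hψ⟩ := hcolor d₀ hd₀ h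
    rw [← hd₀] at hk
    refine hbad (hψ.exists_extension_four (a := P.nbr d₀ 1) (b := P.nbr d₀ 2) (d := P.nbr d₀ 3)
      (hL _) (fun x => ?_) (hadj d₀ hd₀ 0) (hadj d₀ hd₀ 1) (hadj d₀ hd₀ 2) ?_
      (P.nbr_ne_nbr hk 0 2 (by decide)) (P.nbr_ne_nbr hk 1 3 (by decide)))
    · rw [P.adj_iff_exists_nbr hk]
      constructor
      · rintro ⟨i, hi, rfl⟩
        interval_cases i <;> simp [RotationSystem.nbr_zero]
      · rintro (rfl | rfl | rfl | rfl)
        exacts [⟨0, by omega, rfl⟩, ⟨1, by omega, rfl⟩, ⟨2, by omega, rfl⟩, ⟨3, by omega, rfl⟩]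
    · have := hadj d₀ hd₀ 3
      rwa [P.nbr_eq_nbr hk (3 + 1) 0 rfl] at this
  · obtain ⟨d₀, hd₀, h, hw⟩ := P.exists_contractible_of_ncard_eq_five hv hk hcard
    obtain ⟨ψ, hψ⟩ := hcolor d₀ hd₀ h
    rw [← hd₀] at hk
    have hm : P.prevNbr d₀ = P.nbr d₀ 4 := by rw [← h.nbr_pred, hk]
    refine hbad (hψ.exists_extension_five (a := P.nbr d₀ 1) (b := P.nbr d₀ 2) (d := P.nbr d₀ 3)
      (e := P.nbr d₀ 4) (hL _) (fun x => ?_) (hadj d₀ hd₀ 0) (hadj d₀ hd₀ 1) (hadj d₀ hd₀ 2)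
      (hadj d₀ hd₀ 3) ?_ (P.nbr_ne_nbr hk 0 2 (by decide)) (P.nbr_ne_nbr hk 0 3 (by decide))
      (P.nbr_ne_nbr hk 1 3 (by decide)) (P.nbr_ne_nbr hk 2 4 (by decide)) ?_)
    · rw [P.adj_iff_exists_nbr hk]
      constructor
      · rintro ⟨i, hi, rfl⟩
        interval_cases i <;> simp [RotationSystem.nbr_zero]
      · rintro (rfl | rfl | rfl | rfl | rfl)
        exacts [⟨0, by omega, rfl⟩, ⟨1, by omega, rfl⟩, ⟨2, by omega, rfl⟩, ⟨3, by omega, rfl⟩,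
          ⟨4, by omega, rfl⟩]
    · have := hadj d₀ hd₀ 4
      rwa [P.nbr_eq_nbr hk (4 + 1) 0 rfl] at this
    · refine hw.imp_right fun ⟨x, hx, hxv, hx1, hx4⟩ => ?_
      rw [← hm] at hx4 ⊢
      exact P.exists_adj_of_contractible h hcyc hx hxv hx1 hx4
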